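/- arXiv:1406.2862 — 3 statements merged into one kernel-verified Lean document; each statement's English description precedes it below -/
import Mathlib

section
/- Let f ∈ Q̄[X,Y] be an irreducible polynomial defining the curve C = {(x,y) ∈ (Q̄^×)² : f(x,y)=0}, and assume C is not a translate of a subtorus. Then the set C^{1} = {(x,y) ∈ (Q̄^×)² : f(x,y)=0, ((∂f/∂X)(x,y), (∂f/∂Y)(x,y)) ≠ (0,0), and there exist coprime integers (p,q) ≠ (0,0) with x^p y^q = 1 and p·y·(∂f/∂Y)(x,y) = q·x·(∂f/∂X)(x,y)} is finite. (C^{1} is the union over all coprime (p,q) of the singular intersections C ∩_sing H_{p,q}.) -/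
open NumberField IsDedekindDomain MvPolynomial
open scoped Classical

/-- `Qbar` is the field of algebraic numbers, the algebraic closure of `ℚ`. -/
noncomputable abbrev Qbar : Type := AlgebraicClosure ℚ

/-- The curve in the torus `G_m²` cut out by a polynomial `f ∈ Qbar[X,Y]`:
the set of points `(x,y)` with `x, y ≠ 0` and `f(x,y) = 0`. -/
def curve (f : MvPolynomial (Fin 2) Qbar) : Set (Qbar × Qbar) :=
  {P | P.1 ≠ 0 ∧ P.2 ≠ 0 ∧ MvPolynomial.eval ![P.1, P.2] f = 0}

/-- A subset `C` of the torus `G_m²` is a translate of a subtorus if it is of the form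
`{(x,y) : x^a y^b = c}` for some `(a,b) ∈ ℤ² \ {(0,0)}` and some `c ∈ Qbar^×`. -/
def IsSubtorusTranslate (C : Set (Qbar × Qbar)) : Prop :=
  ∃ (a b : ℤ) (c : Qbar), ¬(a = 0 ∧ b = 0) ∧ c ≠ 0 ∧
    C = {P | P.1 ≠ 0 ∧ P.2 ≠ 0 ∧ P.1 ^ a * P.2 ^ b = c}

section Heights

open Height

variable {K : Type*} [Field K] [AdmissibleAbsValues K]

lemma mulHeight_le_prod_mulHeight₁ {ι : Type*} [Fintype ι] (x : ι → K) :
    mulHeight x ≤ ∏ i, mulHeight₁ (x i) := by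
  have hne : ∀ i, (![x i, 1] : Fin 2 → K) ≠ 0 := fun i h ↦ by simpa using congrFun h 1
  simp_rw [mulHeight₁_eq_mulHeight]
  rw [← mulHeight_fun_prod_eq hne]
  convert! mulHeight_comp_le (fun i j ↦ if j = i then (0 : Fin 2) else 1)
    (fun I : ι → Fin 2 ↦ ∏ a, ![x a, 1] (I a)) using 2
  ext i
  rw [Function.comp_apply, Finset.prod_eq_single i] <;> simp +contextual

lemma mulHeight_pow_le (u : K) (n : ℕ) :
    mulHeight (fun j : Fin (n + 1) ↦ u ^ (j : ℕ)) ≤ mulHeight₁ u ^ n := by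
  have hne : ∀ i : Fin n, (![u, 1] : Fin 2 → K) ≠ 0 := fun i h ↦ by simpa using congrFun h 1
  have := mulHeight_fun_prod_eq hne
  rw [Finset.prod_const, Finset.card_univ, Fintype.card_fin, ← mulHeight₁_eq_mulHeight] at this
  rw [← this]
  convert! mulHeight_comp_le (fun (j : Fin (n + 1)) (i : Fin n) ↦ if (i : ℕ) < j then (0 : Fin 2) else 1)
    (fun I : Fin n → Fin 2 ↦ ∏ a, ![u, 1] (I a)) using 2
  ext j
  have h1 : ∀ i : Fin n, (![u, 1] : Fin 2 → K) (if (i : ℕ) < j then (0 : Fin 2) else 1)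
      = if (i : ℕ) < j then u else 1 := fun i ↦ by split_ifs <;> rfl
  simp only [Function.comp_apply, h1]
  rw [Fin.prod_univ_eq_prod_range (fun i ↦ if i < (j : ℕ) then u else 1) n, Finset.prod_ite]
  simp only [Finset.prod_const, one_pow, mul_one]
  have : (Finset.range n).filter (· < (j : ℕ)) = Finset.range j := by
    ext i; simp; omega
  rw [this, Finset.card_range]

lemma mulHeight₁_le_of_isRoot {c : Polynomial K} (hc : c ≠ 0) {α : K} (hα : c.IsRoot α) :
    mulHeight₁ α ≤ (c.natDegree : ℝ) ^ totalWeight K *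
      mulHeight (fun i : Fin (c.natDegree + 1) ↦ c.coeff i) := by
  obtain ⟨t, ht⟩ : ∃ t, c.natDegree = t + 1 :=
    Nat.exists_eq_succ_of_ne_zero fun h ↦ by
      rw [Polynomial.eq_C_of_natDegree_eq_zero h] at hα hc
      simp_all
  set d := c.natDegree with hd
  have hlc : c.coeff d ≠ 0 := by simpa [hd] using hc
  have : Nonempty (Fin d) := ⟨⟨0, by omega⟩⟩
  let A : Fin (d + 1) × Fin d → K := fun ji ↦
    if (ji.1 : ℕ) = d then c.coeff ji.2 else if (ji.1 : ℕ) = ji.2 then -c.coeff d else 0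
  have hrow : (fun j : Fin (d + 1) ↦ ∑ i, A (j, i) * α ^ (i : ℕ))
      = (-c.coeff d) • fun j : Fin (d + 1) ↦ α ^ (j : ℕ) := by
    ext j
    by_cases hj : (j : ℕ) = d
    · have h0 : ∑ i ∈ Finset.range (d + 1), c.coeff i * α ^ i = 0 := by
        rw [← Polynomial.eval_eq_sum_range]; exact hα
      rw [Finset.sum_range_succ, ← Fin.sum_univ_eq_sum_range (fun i ↦ c.coeff i * α ^ i)] at h0
      simp only [A, hj, if_true, Pi.smul_apply, smul_eq_mul]
      linear_combination h0
    · rw [Finset.sum_eq_single ⟨j, by omega⟩]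
      · simp [A, hj]
      · intro i _ hi
        have : (j : ℕ) ≠ i := fun h ↦ hi (Fin.ext h.symm)
        simp [A, hj, this]
      · simp
  have hA : mulHeight A ≤ mulHeight (fun i : Fin (d + 1) ↦ c.coeff i) := by
    have hs : (![1, -1, 0] : Fin 3 → K) ≠ 0 := fun h ↦ by simpa using congrFun h 0
    have hc' : (fun i : Fin (d + 1) ↦ c.coeff i) ≠ 0 := fun h ↦ hlc (congrFun h (Fin.last d))
    have h1 : mulHeight (![1, -1, 0] : Fin 3 → K) ≤ 1 := by
      refine (mulHeight_le_prod_mulHeight₁ _).trans ?_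
      simp [Fin.prod_univ_three]
    calc mulHeight A ≤ mulHeight (fun a : Fin (d + 1) × Fin 3 ↦
          c.coeff a.1 * (![1, -1, 0] : Fin 3 → K) a.2) := by
          convert! mulHeight_comp_le (fun ji : Fin (d + 1) × Fin d ↦
            if (ji.1 : ℕ) = d then (ji.2.castSucc, (0 : Fin 3))
            else if (ji.1 : ℕ) = ji.2 then (Fin.last d, 1) else (Fin.last d, 2))
            (fun a : Fin (d + 1) × Fin 3 ↦ c.coeff a.1 * (![1, -1, 0] : Fin 3 → K) a.2) using 2
          ext ⟨j, i⟩
          simp only [A, Function.comp_apply]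
          split_ifs <;> simp
      _ = _ := mulHeight_fun_mul_eq hc' hs
      _ ≤ _ := mul_le_of_le_one_right (mulHeight_pos _).le h1
  have hle := mulHeight_linearMap_apply_le A (fun i : Fin d ↦ α ^ (i : ℕ))
  rw [hrow, mulHeight_smul_eq_mulHeight _ (neg_ne_zero.mpr hlc), Nat.card_fin] at hle
  have hlow : mulHeight₁ α ^ d ≤ mulHeight (fun j : Fin (d + 1) ↦ α ^ (j : ℕ)) := by
    rw [← mulHeight₁_pow, mulHeight₁_eq_mulHeight]
    convert! mulHeight_comp_le ![Fin.last d, 0] (fun j : Fin (d + 1) ↦ α ^ (j : ℕ)) using 2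
    ext i; fin_cases i <;> simp
  have hup : mulHeight (fun i : Fin d ↦ α ^ (i : ℕ)) ≤ mulHeight₁ α ^ t := by
    rw [ht]; exact mulHeight_pow_le α t
  refine le_of_mul_le_mul_right ?_ (pow_pos (mulHeight₁_pos α) t)
  calc mulHeight₁ α * mulHeight₁ α ^ t = mulHeight₁ α ^ d := by rw [ht, pow_succ']
    _ ≤ _ := hlow.trans hle
    _ ≤ _ := by
      have := mulHeight_pos A
      gcongr

lemma mulHeight₁_intCast_le {n : ℤ} (hn : n ≠ 0) :
    mulHeight₁ (n : K) ≤ (n.natAbs : ℝ) ^ totalWeight K := by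
  have h : mulHeight₁ (n.natAbs : K) ≤ (n.natAbs : ℝ) ^ totalWeight K := by
    simpa using mulHeight₁_sum_le (K := K) (s := Finset.range n.natAbs)
      (by simpa using hn) (fun _ ↦ 1)
  rcases Int.natAbs_eq n with h' | h' <;> rw [h']
  · simpa using h
  · simpa using h

end Heights

lemma NumberField.max_pow_le_mulHeight {K : Type*} [Field K] [NumberField K] {p q : ℤ}
    (hpq : IsCoprime p q) :
    (max |(p : ℝ)| |(q : ℝ)|) ^ Height.totalWeight K ≤ Height.mulHeight ![(p : K), (q : K)] := by
  have hne : ![(p : K), (q : K)] ≠ 0 := fun h ↦ by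
    have h0 : (p : K) = 0 := congrFun h 0
    have h1 : (q : K) = 0 := congrFun h 1
    rw [Int.cast_eq_zero] at h0 h1
    exact not_isCoprime_zero_zero (h0 ▸ h1 ▸ hpq)
  have hsup : ∀ w : K → ℝ, ⨆ i, w (![(p : K), (q : K)] i) = max (w p) (w q) := fun w ↦ by
    refine le_antisymm (ciSup_le fun i ↦ by fin_cases i <;> simp) (max_le ?_ ?_)
    · exact le_ciSup (f := fun i ↦ w (![(p : K), (q : K)] i)) (Set.finite_range _).bddAbove 0
    · exact le_ciSup (f := fun i ↦ w (![(p : K), (q : K)] i)) (Set.finite_range _).bddAbove 1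
  rw [NumberField.mulHeight_eq hne, totalWeight_eq_sum_mult]
  have hinf : ∀ v : InfinitePlace K, ⨆ i, v (![(p : K), (q : K)] i) = max (v p) (v q) :=
    fun v ↦ hsup v
  have hfin : ∀ v : FinitePlace K, ⨆ i, v (![(p : K), (q : K)] i) = max (v p) (v q) :=
    fun v ↦ hsup v
  simp_rw [hinf, hfin]
  rw [← mul_one ((max |(p : ℝ)| |(q : ℝ)|) ^ _), ← Finset.prod_pow_eq_pow_sum]
  refine mul_le_mul ?_ ?_ zero_le_one (by positivity)
  · refine Finset.prod_le_prod (fun _ _ ↦ by positivity) fun v _ ↦ ?_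
    have : ∀ n : ℤ, v (n : K) = |(n : ℝ)| := fun n ↦ by
      rw [← v.norm_embedding_eq]; simp
    simp [this]
  · refine one_le_finprod fun v ↦ ?_
    obtain ⟨r, s, h⟩ := hpq
    have hv : IsNonarchimedean (v ·) := FinitePlace.add_le v
    have H (n : ℤ) : v (n : K) ≤ 1 := IsNonarchimedean.apply_intCast_le_one hv
    have h2 : v ((r : K) * p + s * q) = 1 := by
      have : (r : K) * p + s * q = 1 := by exact_mod_cast congrArg (Int.cast : ℤ → K) h
      rw [this, map_one]
    rw [← h2]
    refine (hv _ _).trans (max_le_max ?_ ?_) <;> simp only [map_mul]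
    · exact mul_le_of_le_one_left (apply_nonneg v _) (H r)
    · exact mul_le_of_le_one_left (apply_nonneg v _) (H s)

section AlgebraicNumbers

open Height Filter

/-- Number fields inside a field `Ω` of characteristic zero, directed by inclusion. -/
abbrev NumberSubfield (Ω : Type*) [Field Ω] [CharZero Ω] : Type _ :=
  {K : IntermediateField ℚ Ω // FiniteDimensional ℚ K}

variable {Ω : Type*} [Field Ω] [CharZero Ω]

instance (K : NumberSubfield Ω) : NumberField K.1 :=
  have := K.2
  { }

instance : Nonempty (NumberSubfield Ω) := ⟨⟨⊥, inferInstance⟩⟩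

instance : IsDirectedOrder (NumberSubfield Ω) where
  directed K L :=
    have := K.2
    have := L.2
    ⟨⟨K.1 ⊔ L.1, inferInstance⟩, le_sup_left (a := K.1), le_sup_right (b := L.1)⟩

variable [Algebra.IsAlgebraic ℚ Ω]

lemma NumberSubfield.eventually_mem (z : Ω) : ∀ᶠ K : NumberSubfield Ω in atTop, z ∈ K.1 :=
  eventually_atTop.mpr ⟨⟨IntermediateField.adjoin ℚ {z}, IntermediateField.adjoin.finiteDimensional
    (Algebra.IsIntegral.isIntegral z)⟩, fun _ hK ↦ hK (IntermediateField.mem_adjoin_simple_self ℚ z)⟩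

lemma exists_forall_logHeight₁_le (a : Ω) : ∃ C : ℝ, 0 ≤ C ∧ ∀ (K : NumberSubfield Ω) (b : K.1),
    (b : Ω) = a → logHeight₁ b ≤ C * totalWeight K.1 := by
  obtain ⟨P, hP, hPa⟩ : IsAlgebraic ℤ a :=
    (IsFractionRing.isAlgebraic_iff ℤ ℚ Ω).mpr (Algebra.IsAlgebraic.isAlgebraic a)
  let w : ℤ → ℝ := fun n ↦ if n = 0 then 1 else (n.natAbs : ℝ)
  have hw : ∀ n, 1 ≤ w n := fun n ↦ by
    simp only [w]
    split_ifs with h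
    · rfl
    · exact_mod_cast Nat.one_le_iff_ne_zero.mpr (by simpa using h)
  let B : ℝ := P.natDegree * ∏ i : Fin (P.natDegree + 1), w (P.coeff i)
  refine ⟨|Real.log B|, abs_nonneg _, fun K b hb ↦ ?_⟩
  let c : Polynomial K.1 := P.map (Int.castRingHom K.1)
  have hinj : Function.Injective (Int.castRingHom K.1) := (Int.castRingHom K.1).injective_int
  have hdeg : c.natDegree = P.natDegree := Polynomial.natDegree_map_eq_of_injective hinj P
  have hroot : c.IsRoot b := by
    rw [Polynomial.IsRoot, Polynomial.eval_map]
    apply Subtype.val_injective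
    rw [← hb, Polynomial.aeval_def] at hPa
    change (algebraMap K.1 Ω) _ = _
    rw [Polynomial.hom_eval₂, Subsingleton.elim ((algebraMap K.1 Ω).comp _) (algebraMap ℤ Ω)]
    exact hPa
  have hle := mulHeight₁_le_of_isRoot ((Polynomial.map_ne_zero_iff hinj).mpr hP) hroot
  change mulHeight₁ b ≤ (c.natDegree : ℝ) ^ totalWeight K.1 *
      mulHeight (fun i : Fin (c.natDegree + 1) ↦ c.coeff i) at hle
  rw [hdeg] at hle
  have hprod : mulHeight (fun i : Fin (P.natDegree + 1) ↦ c.coeff i) ≤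
      (∏ i : Fin (P.natDegree + 1), w (P.coeff i)) ^ totalWeight K.1 := by
    refine (mulHeight_le_prod_mulHeight₁ _).trans ?_
    rw [← Finset.prod_pow]
    refine Finset.prod_le_prod (fun _ _ ↦ (mulHeight₁_pos _).le) fun i _ ↦ ?_
    by_cases h : P.coeff i = 0
    · simp [c, w, h]
    · simpa [c, w, h] using mulHeight₁_intCast_le (K := K.1) h
  have hB : mulHeight₁ b ≤ B ^ totalWeight K.1 := by
    refine hle.trans ?_
    rw [mul_pow]
    gcongr
  rw [logHeight₁_eq_log_mulHeight₁, mul_comm]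
  refine (Real.log_le_log (mulHeight₁_pos b) hB).trans ?_
  rw [Real.log_pow]
  gcongr
  exact le_abs_self _

lemma exists_eventually_logHeight₁_le_of_evalEval_eq_zero (G : Polynomial (Polynomial Ω))
    (hG : ∀ u, G.eval (Polynomial.C u) ≠ 0) :
    ∃ C : ℝ, 0 ≤ C ∧ ∀ᶠ K : NumberSubfield Ω in atTop, ∀ x u : K.1,
      G.evalEval (x : Ω) (u : Ω) = 0 →
        logHeight₁ x ≤ G.natDegree * logHeight₁ u + C * totalWeight K.1 := by
  set n := G.natDegree with hn
  let m := (Finset.range (n + 1)).sup fun j ↦ (G.coeff j).natDegree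
  choose C hC0 hC using exists_forall_logHeight₁_le (Ω := Ω)
  let S : ℝ := ∑ ij : Fin (m + 1) × Fin (n + 1), C ((G.coeff ij.2).coeff ij.1)
  have hS : 0 ≤ S := Finset.sum_nonneg fun _ _ ↦ hC0 _
  have hlog : ∀ k : ℕ, 0 ≤ Real.log (k + 1) := fun k ↦ Real.log_nonneg (by simp)
  refine ⟨Real.log (m + 1) + Real.log (n + 1) + S, by have := hlog m; have := hlog n; positivity, ?_⟩
  have hmem : ∀ᶠ K : NumberSubfield Ω in atTop, ∀ ij : Fin (m + 1) × Fin (n + 1),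
      (G.coeff ij.2).coeff ij.1 ∈ K.1 :=
    eventually_all.mpr fun _ ↦ NumberSubfield.eventually_mem _
  filter_upwards [hmem] with K hK x u hxu
  have hcoeff : ∀ i, (G.eval (Polynomial.C (u : Ω))).coeff i =
      ∑ j : Fin (n + 1), (G.coeff j).coeff i * (u : Ω) ^ (j : ℕ) := fun i ↦ by
    rw [Polynomial.eval_eq_sum_range, ← hn, ← Fin.sum_univ_eq_sum_range
      (fun j ↦ G.coeff j * Polynomial.C (u : Ω) ^ j), Polynomial.finsetSum_coeff]
    simp_rw [← Polynomial.C_pow, Polynomial.coeff_mul_C]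
  have hm : ∀ i, m < i → ∀ j : Fin (n + 1), (G.coeff j).coeff i = 0 := fun i hi j ↦
    Polynomial.coeff_eq_zero_of_natDegree_lt (lt_of_le_of_lt
      (Finset.le_sup (f := fun j ↦ (G.coeff j).natDegree) (Finset.mem_range.mpr j.2)) hi)
  obtain ⟨c, hc⟩ : ∃ c : Polynomial K.1,
      c.map (algebraMap K.1 Ω) = G.eval (Polynomial.C (u : Ω)) := by
    rw [← Polynomial.mem_lifts, Polynomial.lifts_iff_coeff_lifts]
    intro i
    rw [hcoeff]
    suffices h : ∑ j : Fin (n + 1), (G.coeff j).coeff i * (u : Ω) ^ (j : ℕ) ∈ K.1 from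
      ⟨⟨_, h⟩, rfl⟩
    refine sum_mem fun j _ ↦ mul_mem ?_ (pow_mem u.2 _)
    rcases lt_or_ge m i with h | h
    · rw [hm i h j]; exact zero_mem _
    · exact hK (⟨i, by omega⟩, j)
  have hc0 : c ≠ 0 := fun h ↦ hG u (by rw [← hc, h, Polynomial.map_zero])
  have hroot : c.IsRoot x := by
    apply (algebraMap K.1 Ω).injective
    rw [map_zero, ← Polynomial.eval_map_apply, hc]
    exact hxu
  have hdm : c.natDegree ≤ m := by
    rw [← Polynomial.natDegree_map (algebraMap K.1 Ω), hc, Polynomial.natDegree_le_iff_coeff_eq_zero]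
    intro i hi
    rw [hcoeff]
    exact Finset.sum_eq_zero fun j _ ↦ by rw [hm i hi j, zero_mul]
  let A : Fin (m + 1) × Fin (n + 1) → K.1 := fun ij ↦ ⟨_, hK ij⟩
  have hA : logHeight A ≤ S * totalWeight K.1 := by
    rw [logHeight_eq_log_mulHeight]
    refine (Real.log_le_log (mulHeight_pos A) (mulHeight_le_prod_mulHeight₁ A)).trans ?_
    rw [Real.log_prod fun _ _ ↦ mulHeight₁_ne_zero _, Finset.sum_mul]
    exact Finset.sum_le_sum fun ij _ ↦ hC _ K _ rfl
  have hcA : ∀ i : Fin (m + 1), c.coeff i = ∑ j, A (i, j) * u ^ (j : ℕ) := fun i ↦ by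
    apply (algebraMap K.1 Ω).injective
    rw [← Polynomial.coeff_map, hc, hcoeff, map_sum]
    rfl
  have h1 := mulHeight₁_le_of_isRoot hc0 hroot
  have h2 : mulHeight (fun i : Fin (c.natDegree + 1) ↦ c.coeff i) ≤
      mulHeight (fun i : Fin (m + 1) ↦ c.coeff i) :=
    mulHeight_comp_le (Fin.castLE (by omega)) (fun i : Fin (m + 1) ↦ c.coeff i)
  have h3 := mulHeight_linearMap_apply_le A (fun j : Fin (n + 1) ↦ u ^ (j : ℕ))
  have h4 : mulHeight₁ x ≤ ((m + 1 : ℝ)) ^ totalWeight K.1 *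
      ((n + 1 : ℝ) ^ totalWeight K.1 * mulHeight A * mulHeight₁ u ^ n) := by
    refine h1.trans (mul_le_mul ?_ (h2.trans ?_) (mulHeight_pos _).le (by positivity))
    · gcongr
      exact_mod_cast hdm.trans m.le_succ
    · simp_rw [hcA]
      refine h3.trans ?_
      have := mulHeight_pos A
      have := mulHeight_pow_le u n
      rw [Nat.card_fin]
      push_cast
      gcongr
  have hApos := mulHeight_pos A
  have hupos := mulHeight₁_pos u
  have h5 := Real.log_le_log (mulHeight₁_pos x) h4
  rw [Real.log_mul (by positivity) (by positivity), Real.log_mul (by positivity) (by positivity),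
    Real.log_mul (by positivity) (by positivity), Real.log_pow, Real.log_pow, Real.log_pow,
    ← logHeight_eq_log_mulHeight, ← logHeight₁_eq_log_mulHeight₁,
    ← logHeight₁_eq_log_mulHeight₁] at h5
  linarith

lemma exists_eventually_logHeight₁_eval_le (F : MvPolynomial (Fin 2) Ω) {B : ℝ} (hB : 0 ≤ B) :
    ∃ C : ℝ, 0 ≤ C ∧ ∀ᶠ K : NumberSubfield Ω in atTop, ∀ x y : K.1,
      logHeight₁ x ≤ B * totalWeight K.1 → logHeight₁ y ≤ B * totalWeight K.1 →
      ∃ z : K.1, (z : Ω) = MvPolynomial.eval ![(x : Ω), (y : Ω)] F ∧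
        logHeight₁ z ≤ C * totalWeight K.1 := by
  induction F using MvPolynomial.induction_on with
  | C a =>
    obtain ⟨C, hC0, hC⟩ := exists_forall_logHeight₁_le a
    refine ⟨C, hC0, ?_⟩
    filter_upwards [NumberSubfield.eventually_mem a] with K hK x y _ _
    exact ⟨⟨a, hK⟩, by simp, hC K _ rfl⟩
  | add p q hp hq =>
    obtain ⟨C, hC0, hC⟩ := hp
    obtain ⟨D, hD0, hD⟩ := hq
    refine ⟨Real.log 2 + C + D, by positivity, ?_⟩
    filter_upwards [hC, hD] with K hCK hDK x y hx hy
    obtain ⟨z, hz, hzC⟩ := hCK x y hx hy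
    obtain ⟨w, hw, hwD⟩ := hDK x y hx hy
    refine ⟨z + w, by simp [hz, hw], (logHeight₁_add_le z w).trans ?_⟩
    linarith
  | mul_X p i hp =>
    obtain ⟨C, hC0, hC⟩ := hp
    refine ⟨C + B, by positivity, ?_⟩
    filter_upwards [hC] with K hCK x y hx hy
    obtain ⟨z, hz, hzC⟩ := hCK x y hx hy
    refine ⟨z * ![x, y] i, ?_, (logHeight₁_mul_le z _).trans ?_⟩
    · fin_cases i <;> simp [hz]
    · have : logHeight₁ (![x, y] i) ≤ B * totalWeight K.1 := by fin_cases i <;> assumption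
      linarith

end AlgebraicNumbers

section BoundedHeight

open Height Filter

lemma exists_int_int_mul_abs_sub_le (p q : ℤ) {n : ℕ} (hn : 0 < n) :
    ∃ a b : ℤ, ¬ (a = 0 ∧ b = 0) ∧ |a| ≤ n + 1 ∧ |b| ≤ n + 1 ∧
      (n + 1) * |a * q - b * p| ≤ max |p| |q| := by
  wlog hpq : |p| ≤ |q| generalizing p q
  · obtain ⟨a, b, hab, ha, hb, h⟩ := this q p (le_of_not_ge hpq)
    exact ⟨b, a, by tauto, hb, ha, by rwa [abs_sub_comm, max_comm]⟩
  rcases eq_or_ne q 0 with rfl | hq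
  · obtain rfl : p = 0 := by simpa using hpq
    exact ⟨1, 0, by simp, by simp, by simp; omega, by simp⟩
  obtain ⟨a, b, hb, hbn, h⟩ := Real.exists_int_int_abs_mul_sub_le ((p : ℝ) / q) hn
  have hq' : (0 : ℝ) < |(q : ℝ)| := by positivity
  have hn' : (0 : ℝ) < n + 1 := by positivity
  have h1 : (n + 1) * |(a : ℝ) * q - b * p| ≤ |(q : ℝ)| := by
    have : (a : ℝ) * q - b * p = -((b * (p / q) - a) * q) := by
      field_simp
      ring
    rw [this, abs_neg, abs_mul, ← mul_assoc]
    refine mul_le_of_le_one_left hq'.le ?_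
    rwa [le_div_iff₀' hn'] at h
  have h2 : |(a : ℝ)| < n + 2 := by
    have hle : |(p : ℝ) / q| ≤ 1 := by
      rw [abs_div, div_le_one hq']
      exact_mod_cast hpq
    have hb' : |(b : ℝ)| ≤ n := by
      rw [abs_of_pos (by exact_mod_cast hb)]
      exact_mod_cast hbn
    have h3 : (1 : ℝ) / (n + 1) ≤ 1 := by
      rw [div_le_one hn']
      linarith [n.cast_nonneg (α := ℝ)]
    have h4 : |(b : ℝ) * (p / q)| ≤ n := by
      rw [abs_mul]
      exact (mul_le_of_le_one_right (abs_nonneg _) hle).trans hb'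
    calc |(a : ℝ)| = |(b : ℝ) * (p / q) - (b * (p / q) - a)| := by rw [sub_sub_cancel]
      _ ≤ |(b : ℝ) * (p / q)| + |(b : ℝ) * (p / q) - a| := abs_sub _ _
      _ < n + 2 := by linarith
  refine ⟨a, b, by omega, ?_, ?_, ?_⟩
  · have : |a| < n + 2 := by exact_mod_cast h2
    omega
  · rw [abs_of_pos hb]
    omega
  · rw [max_eq_right hpq]
    exact_mod_cast h1

variable {Ω : Type*} [Field Ω] [CharZero Ω]

lemma NumberSubfield.coe_zpow_mul_zpow (K : NumberSubfield Ω) (x y : K.1) (a b : ℤ) :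
    ((x ^ a * y ^ b : K.1) : Ω) = (x : Ω) ^ a * (y : Ω) ^ b := by
  simp [← IntermediateField.algebraMap_apply]

/-- If all points of a subset of the torus satisfy `h(x), h(y) ≤ D h(x ^ a y ^ b) + O(1)` for each
`(a, b) ≠ 0`, with `D` independent of `(a, b)`, then those points that lie on a one-dimensional
subtorus have bounded height. -/
lemma exists_eventually_logHeight₁_le_of_zpow_mul_zpow_eq_one (S : Set (Ω × Ω)) (D : ℕ)
    (hS : ∀ a b : ℤ, ¬ (a = 0 ∧ b = 0) → ∃ C : ℝ, 0 ≤ C ∧ ∀ᶠ K : NumberSubfield Ω in atTop,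
      ∀ x y : K.1, x ≠ 0 → y ≠ 0 → ((x : Ω), (y : Ω)) ∈ S →
        logHeight₁ x ≤ D * logHeight₁ (x ^ a * y ^ b) + C * totalWeight K.1 ∧
        logHeight₁ y ≤ D * logHeight₁ (x ^ a * y ^ b) + C * totalWeight K.1) :
    ∃ B : ℝ, 0 ≤ B ∧ ∀ᶠ K : NumberSubfield Ω in atTop,
      ∀ x y : K.1, x ≠ 0 → y ≠ 0 → ((x : Ω), (y : Ω)) ∈ S → ∀ p q : ℤ, IsCoprime p q →
        x ^ p * y ^ q = 1 →
        logHeight₁ x ≤ B * totalWeight K.1 ∧ logHeight₁ y ≤ B * totalWeight K.1 := by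
  choose! C hC0 hC using hS
  let n := 2 * D + 1
  let box : Finset (ℤ × ℤ) := (Finset.Icc (-(n + 1 : ℤ)) (n + 1) ×ˢ
    Finset.Icc (-(n + 1 : ℤ)) (n + 1)).filter fun ab ↦ ¬ (ab.1 = 0 ∧ ab.2 = 0)
  have hbox0 : ∀ ab ∈ box, 0 ≤ C ab.1 ab.2 := fun ab hab ↦ hC0 _ _ (Finset.mem_filter.mp hab).2
  refine ⟨2 * ∑ ab ∈ box, C ab.1 ab.2, mul_nonneg two_pos.le (Finset.sum_nonneg hbox0), ?_⟩
  have hall := (eventually_all_finset box).mpr fun ab hab ↦ hC ab.1 ab.2 (Finset.mem_filter.mp hab).2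
  filter_upwards [hall] with K hK x y hx hy hxy p q ⟨r, s, hrs⟩ h1
  obtain ⟨a, b, hab, ha, hb, hle⟩ := exists_int_int_mul_abs_sub_le p q (n := n) (by omega)
  have hmem : (a, b) ∈ box := by
    simp only [box, Finset.mem_filter, Finset.mem_product, Finset.mem_Icc, ← abs_le]
    exact ⟨⟨ha, hb⟩, hab⟩
  obtain ⟨hKx, hKy⟩ := hK _ hmem x y hx hy hxy
  have hCle : C a b ≤ ∑ ab ∈ box, C ab.1 ab.2 := Finset.single_le_sum hbox0 hmem
  set A := ∑ ab ∈ box, C ab.1 ab.2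
  set t : K.1 := x ^ s * y ^ (-r) with ht
  have hxt : x = t ^ q := by
    have : x = (x ^ s * y ^ (-r)) ^ q * (x ^ p * y ^ q) ^ r := by
      rw [mul_zpow, mul_zpow, ← zpow_mul, ← zpow_mul, ← zpow_mul, ← zpow_mul, mul_mul_mul_comm,
        ← zpow_add₀ hx, ← zpow_add₀ hy, show s * q + p * r = 1 by linarith,
        show -r * q + q * r = 0 by ring]
      simp
    rwa [h1, one_zpow, mul_one] at this
  have hyt : y = t ^ (-p) := by
    have : y = (x ^ s * y ^ (-r)) ^ (-p) * (x ^ p * y ^ q) ^ s := by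
      rw [mul_zpow, mul_zpow, ← zpow_mul, ← zpow_mul, ← zpow_mul, ← zpow_mul, mul_mul_mul_comm,
        ← zpow_add₀ hx, ← zpow_add₀ hy, show s * -p + p * s = 0 by ring,
        show -r * -p + q * s = 1 by linarith]
      simp
    rwa [h1, one_zpow, mul_one] at this
  have ht0 : t ≠ 0 := mul_ne_zero (zpow_ne_zero _ hx) (zpow_ne_zero _ hy)
  have hut : x ^ a * y ^ b = t ^ (a * q - b * p) := by
    rw [hxt, hyt, ← zpow_mul, ← zpow_mul, ← zpow_add₀ ht0]
    congr 1
    ring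
  rw [hut] at hKx hKy
  clear_value t
  subst hxt hyt
  simp only [logHeight₁_zpow, Int.natAbs_neg, Nat.cast_natAbs, Int.cast_abs] at hKx hKy ⊢
  have hh : 0 ≤ logHeight₁ t := zero_le_logHeight₁ t
  have htw : (0 : ℝ) ≤ totalWeight K.1 := by positivity
  have hle' : ((2 * D + 1 : ℕ) + 1) * |((a * q - b * p : ℤ) : ℝ)| ≤ max |(p : ℝ)| |(q : ℝ)| := by
    exact_mod_cast hle
  set δ := |((a * q - b * p : ℤ) : ℝ)|
  have hδ : 0 ≤ δ := abs_nonneg _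
  set M := max |(p : ℝ)| |(q : ℝ)| with hM
  push_cast at hle'
  have hMh : M * logHeight₁ t ≤ D * (δ * logHeight₁ t) + C a b * totalWeight K.1 := by
    rcases max_choice |(p : ℝ)| |(q : ℝ)| with h | h <;> rw [hM, h] <;> assumption
  have hDδ : 2 * (D * (δ * logHeight₁ t)) ≤ M * logHeight₁ t := by
    calc 2 * (D * (δ * logHeight₁ t)) = (2 * D * δ) * logHeight₁ t := by ring
      _ ≤ M * logHeight₁ t := by gcongr; linarith
  have hCt : C a b * totalWeight K.1 ≤ A * totalWeight K.1 := by gcongr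
  have hq : |(q : ℝ)| * logHeight₁ t ≤ M * logHeight₁ t := by gcongr; exact le_max_right _ _
  have hp : |(p : ℝ)| * logHeight₁ t ≤ M * logHeight₁ t := by gcongr; exact le_max_left _ _
  constructor <;> linarith

variable [Algebra.IsAlgebraic ℚ Ω]

/-- Coprime integers `p, q` with `(p : q) = (A(x, y) : B(x, y))` for polynomials `A, B` are bounded
in terms of a bound for the heights of `x` and `y`. -/
lemma exists_eventually_abs_le_of_mul_eval_eq (A B : MvPolynomial (Fin 2) Ω) {R : ℝ} (hR : 0 ≤ R) :
    ∃ M : ℝ, ∀ᶠ K : NumberSubfield Ω in atTop, ∀ x y : K.1,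
      logHeight₁ x ≤ R * totalWeight K.1 → logHeight₁ y ≤ R * totalWeight K.1 →
      ¬ (eval ![(x : Ω), (y : Ω)] A = 0 ∧ eval ![(x : Ω), (y : Ω)] B = 0) →
      ∀ p q : ℤ, IsCoprime p q →
        (p : Ω) * eval ![(x : Ω), (y : Ω)] B = q * eval ![(x : Ω), (y : Ω)] A →
        max |(p : ℝ)| |(q : ℝ)| ≤ M := by
  obtain ⟨C₀, -, h₀⟩ := exists_eventually_logHeight₁_eval_le A hR
  obtain ⟨C₁, -, h₁⟩ := exists_eventually_logHeight₁_eval_le B hR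
  refine ⟨Real.exp (C₀ + C₁), ?_⟩
  filter_upwards [h₀, h₁] with K h₀ h₁ x y hx hy hne p q hpq hslope
  obtain ⟨z₀, hz₀, hle₀⟩ := h₀ x y hx hy
  obtain ⟨z₁, hz₁, hle₁⟩ := h₁ x y hx hy
  rw [← hz₀, ← hz₁] at hne hslope
  have hslope' : (p : K.1) * z₁ = q * z₀ := Subtype.val_injective (by simpa using hslope)
  have hne' : ¬ (z₀ = 0 ∧ z₁ = 0) := by simpa using hne
  have hpq0 : ¬ (p = 0 ∧ q = 0) := by
    rintro ⟨rfl, rfl⟩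
    exact not_isCoprime_zero_zero hpq
  obtain ⟨c, hc, hcz⟩ : ∃ c : K.1, c ≠ 0 ∧ ![(p : K.1), (q : K.1)] = c • ![z₀, z₁] := by
    by_cases hz : z₁ = 0
    · subst hz
      have hz0 : z₀ ≠ 0 := fun h ↦ hne' ⟨h, rfl⟩
      have hq : q = 0 := by simpa [hz0] using hslope'.symm
      refine ⟨p / z₀, div_ne_zero (by simp; tauto) hz0, ?_⟩
      simp [hz0, hq]
    · have hq : q ≠ 0 := by
        rintro rfl
        simp [hz] at hslope'
        tauto
      refine ⟨q / z₁, div_ne_zero (by simpa using hq) hz, ?_⟩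
      have : (p : K.1) = q / z₁ * z₀ := by
        field_simp
        exact hslope'
      simp [hz, ← this]
  have hle : (max |(p : ℝ)| |(q : ℝ)|) ^ totalWeight K.1 ≤ mulHeight₁ z₀ * mulHeight₁ z₁ := by
    refine (NumberField.max_pow_le_mulHeight (K := K.1) hpq).trans ?_
    rw [hcz, mulHeight_smul_eq_mulHeight _ hc]
    simpa using mulHeight_le_prod_mulHeight₁ ![z₀, z₁]
  rw [← pow_le_pow_iff_left₀ (by positivity) (Real.exp_pos _).le (totalWeight_pos K.1).ne',
    ← Real.exp_nat_mul]
  refine hle.trans ?_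
  rw [← Real.exp_log (mulHeight₁_pos z₀), ← Real.exp_log (mulHeight₁_pos z₁), ← Real.exp_add,
    Real.exp_le_exp, ← logHeight₁_eq_log_mulHeight₁, ← logHeight₁_eq_log_mulHeight₁]
  linarith

end BoundedHeight

section FunctionField
open scoped IntermediateField

variable {k L : Type*} [Field k] [Field L] [Algebra k L]

lemma Polynomial.aevalAeval_eq_eval₂ (x v : L) (G : Polynomial (Polynomial k)) :
    G.aevalAeval x v = G.eval₂ (Polynomial.aeval (R := k) x).toRingHom v := by
  have : (Polynomial.aevalAeval (R := k) x v).toRingHom =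
      Polynomial.eval₂RingHom (Polynomial.aeval (R := k) x).toRingHom v := by
    ext <;> simp
  exact congr($this G)

open scoped IntermediateField.algebraAdjoinAdjoin in
lemma exists_ne_zero_natDegree_le_aevalAeval_eq_zero {x y u : L} (hx : Transcendental k x)
    {F : Polynomial (Polynomial k)} (hF : F ≠ 0) (hFxy : F.aevalAeval x y = 0)
    (hu : u ∈ (k⟮x⟯)⟮y⟯) :
    ∃ G : Polynomial (Polynomial k), G ≠ 0 ∧ G.natDegree ≤ F.natDegree ∧
      G.aevalAeval x u = 0 := by
  let φ : Polynomial k →+* k⟮x⟯ :=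
    (Polynomial.aeval (⟨x, IntermediateField.mem_adjoin_simple_self k x⟩ : k⟮x⟯)).toRingHom
  have hφ : (algebraMap k⟮x⟯ L).comp φ = (Polynomial.aeval (R := k) x).toRingHom := by
    ext
    · simp [φ, ← IsScalarTower.algebraMap_apply k k⟮x⟯ L]
    · simp [φ]
  have hφinj : Function.Injective φ := by
    refine (injective_iff_map_eq_zero φ).mpr fun p hp ↦ (transcendental_iff.mp hx) p ?_
    have := congr($hφ p)
    simpa [hp] using this.symm
  have hFy : Polynomial.aeval y (F.map φ) = 0 := by
    rw [Polynomial.aeval_def, Polynomial.eval₂_map, hφ, ← Polynomial.aevalAeval_eq_eval₂, hFxy]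
  have hF' : F.map φ ≠ 0 := (Polynomial.map_ne_zero_iff hφinj).mpr hF
  have hy : IsIntegral k⟮x⟯ y := isAlgebraic_iff_isIntegral.mp ⟨_, hF', hFy⟩
  have hdeg : Module.finrank k⟮x⟯ (k⟮x⟯)⟮y⟯ ≤ F.natDegree := by
    rw [IntermediateField.adjoin.finrank hy]
    refine (Polynomial.natDegree_le_natDegree (minpoly.degree_le_of_ne_zero _ _ hF' hFy)).trans ?_
    exact Polynomial.natDegree_map_le
  have := IntermediateField.adjoin.finiteDimensional hy
  have hdep : ¬ LinearIndependent k⟮x⟯ fun i : Fin (F.natDegree + 1) ↦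
      (⟨u, hu⟩ : (k⟮x⟯)⟮y⟯) ^ (i : ℕ) := fun h ↦ by
    have := h.fintype_card_le_finrank
    simp at this
    omega
  have hdep' : ¬ LinearIndependent (Algebra.adjoin k {x}) fun i : Fin (F.natDegree + 1) ↦
      u ^ (i : ℕ) := by
    rw [LinearIndependent.iff_fractionRing (Algebra.adjoin k {x}) k⟮x⟯]
    intro h
    refine hdep (LinearIndependent.of_comp (IntermediateField.val _).toLinearMap ?_)
    simpa [Function.comp_def] using h
  obtain ⟨c, hc, i₀, hi₀⟩ := Fintype.not_linearIndependent_iff.mp hdep'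
  have hp (i) : ∃ p : Polynomial k, Polynomial.aeval x p = (c i : L) := by
    exact (Algebra.adjoin_singleton_eq_range_aeval k x).le (c i).2
  choose p hp using hp
  refine ⟨∑ i : Fin (F.natDegree + 1), Polynomial.monomial (i : ℕ) (p i), fun h ↦ hi₀ ?_, ?_, ?_⟩
  · have := congr(Polynomial.coeff $h i₀)
    rw [Polynomial.finsetSum_coeff] at this
    simp [Polynomial.coeff_monomial, Fin.val_inj] at this
    have h2 := hp i₀
    rw [this] at h2
    simpa using h2.symm
  · refine Polynomial.natDegree_sum_le_of_forall_le _ _ fun i _ ↦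
      (Polynomial.natDegree_monomial_le _).trans (by omega)
  · rw [map_sum, ← hc]
    refine Finset.sum_congr rfl fun i _ ↦ ?_
    rw [Polynomial.aevalAeval_eq_eval₂, Polynomial.eval₂_monomial]
    change Polynomial.aeval x (p i) * _ = _
    rw [hp]
    rfl

lemma exists_natDegree_le_aevalAeval_eq_zero_forall_eval_ne_zero {x y u : L}
    (hx : Transcendental k x) {F : Polynomial (Polynomial k)} (hF : F ≠ 0)
    (hFxy : F.aevalAeval x y = 0) (hu : u ∈ (k⟮x⟯)⟮y⟯) (hu' : u ∉ Set.range (algebraMap k L)) :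
    ∃ G : Polynomial (Polynomial k), G.natDegree ≤ F.natDegree ∧
      G.aevalAeval x u = 0 ∧ ∀ u₀, G.eval (Polynomial.C u₀) ≠ 0 := by
  have hex : ∃ d, ∃ G : Polynomial (Polynomial k), G ≠ 0 ∧ G.natDegree = d ∧
      G.aevalAeval x u = 0 := by
    obtain ⟨G, h0, -, h⟩ := exists_ne_zero_natDegree_le_aevalAeval_eq_zero hx hF hFxy hu
    exact ⟨_, G, h0, rfl, h⟩
  obtain ⟨G, hG0, hGd, hG⟩ := Nat.find_spec hex
  refine ⟨G, ?_, hG, fun u₀ hu₀ ↦ ?_⟩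
  · obtain ⟨G', h0, hle, h⟩ := exists_ne_zero_natDegree_le_aevalAeval_eq_zero hx hF hFxy hu
    rw [hGd]
    exact (Nat.find_min' hex ⟨G', h0, rfl, h⟩).trans hle
  · obtain ⟨G', rfl⟩ := Polynomial.dvd_iff_isRoot.mpr hu₀
    have h0 : G' ≠ 0 := right_ne_zero_of_mul hG0
    rw [map_mul, mul_eq_zero] at hG
    have hG' := hG.resolve_left fun h ↦ hu' ⟨u₀, by
      simp at h
      exact (sub_eq_zero.mp h).symm⟩
    have := Nat.find_min' hex ⟨G', h0, rfl, hG'⟩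
    rw [← hGd, Polynomial.natDegree_mul (Polynomial.X_sub_C_ne_zero _) h0,
      Polynomial.natDegree_X_sub_C] at this
    omega

end FunctionField

section LaurentMonomials

universe v
variable {k : Type v} [Field k]

lemma exists_irreducible_generic_point {f : MvPolynomial (Fin 2) k} (hf : Irreducible f) :
    ∃ (L : Type v) (_ : Field L) (_ : Algebra k L) (ξ η : L),
      ∀ g : MvPolynomial (Fin 2) k, aeval ![ξ, η] g = 0 ↔ f ∣ g := by
  have hp : (Ideal.span {f}).IsPrime := (Ideal.span_singleton_prime hf.ne_zero).mpr hf.prime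
  let A := MvPolynomial (Fin 2) k ⧸ Ideal.span {f}
  let π : MvPolynomial (Fin 2) k →ₐ[k] FractionRing A :=
    (IsScalarTower.toAlgHom k A (FractionRing A)).comp (Ideal.Quotient.mkₐ k (Ideal.span {f}))
  refine ⟨FractionRing A, inferInstance, inferInstance, π (X 0), π (X 1), fun g ↦ ?_⟩
  have : aeval ![π (X 0), π (X 1)] = π := by
    ext i
    fin_cases i <;> simp
  rw [this, ← Ideal.mem_span_singleton, ← Ideal.Quotient.eq_zero_iff_mem]
  exact map_eq_zero_iff (algebraMap A (FractionRing A)) (IsFractionRing.injective A _)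

/-- Substituting Laurent monomials `cᵢ x ^ αᵢ y ^ βᵢ` in a polynomial gives a polynomial up to
a power of `x y`. -/
lemma exists_aeval_eq_mul_aeval_laurent (F : MvPolynomial (Fin 2) k) (c : Fin 2 → k)
    (α β : Fin 2 → ℤ) : ∃ (H : MvPolynomial (Fin 2) k) (e : ℕ),
      ∀ (L : Type v) [Field L] [Algebra k L] (x y : L), x ≠ 0 → y ≠ 0 →
        aeval ![x, y] H =
          (x * y) ^ e * aeval (fun i ↦ algebraMap k L (c i) * x ^ α i * y ^ β i) F := by
  induction F using MvPolynomial.induction_on with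
  | C a => exact ⟨C a, 0, fun L _ _ x y _ _ ↦ by simp⟩
  | add p q hp hq =>
    obtain ⟨H₁, e₁, h₁⟩ := hp
    obtain ⟨H₂, e₂, h₂⟩ := hq
    refine ⟨H₁ * (X 0 * X 1) ^ e₂ + H₂ * (X 0 * X 1) ^ e₁, e₁ + e₂, fun L _ _ x y hx hy ↦ ?_⟩
    simp [h₁ L x y hx hy, h₂ L x y hx hy]
    ring
  | mul_X p i hp =>
    obtain ⟨H, e, h⟩ := hp
    let N := (α i).natAbs + (β i).natAbs
    obtain ⟨A, hA⟩ := Int.eq_ofNat_of_zero_le (show 0 ≤ (N : ℤ) + α i by omega)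
    obtain ⟨B, hB⟩ := Int.eq_ofNat_of_zero_le (show 0 ≤ (N : ℤ) + β i by omega)
    refine ⟨H * (C (c i) * X 0 ^ A * X 1 ^ B), e + N, fun L _ _ x y hx hy ↦ ?_⟩
    have hxA : x ^ A = x ^ N * x ^ α i := by
      rw [← zpow_natCast, ← hA, zpow_add₀ hx, zpow_natCast]
    have hyB : y ^ B = y ^ N * y ^ β i := by
      rw [← zpow_natCast, ← hB, zpow_add₀ hy, zpow_natCast]
    simp [h L x y hx hy, hxA, hyB]
    ring

lemma aeval_laurent_eq_zero_of_generic {f : MvPolynomial (Fin 2) k} {L : Type v} [Field L]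
    [Algebra k L] {ξ η : L} (hgen : ∀ g : MvPolynomial (Fin 2) k, aeval ![ξ, η] g = 0 → f ∣ g)
    (hξ : ξ ≠ 0) (hη : η ≠ 0) (F : MvPolynomial (Fin 2) k) (α β : Fin 2 → ℤ)
    (hF : aeval (fun i ↦ ξ ^ α i * η ^ β i) F = 0) {x y : k} (hx : x ≠ 0) (hy : y ≠ 0)
    (hxy : eval ![x, y] f = 0) : eval (fun i ↦ x ^ α i * y ^ β i) F = 0 := by
  obtain ⟨H, e, h⟩ := exists_aeval_eq_mul_aeval_laurent F 1 α β
  obtain ⟨g, rfl⟩ := hgen H (by simp [h L ξ η hξ hη, hF])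
  have := h k x y hx hy
  simpa [aeval_eq_eval, hxy, hx, hy] using this.symm

lemma IsAlgebraic.mem_range_algebraMap_of_isAlgClosed [IsAlgClosed k] {L : Type*} [Field L]
    [Algebra k L] {z : L} (hz : IsAlgebraic k z) : z ∈ Set.range (algebraMap k L) := by
  have := minpoly.mem_range_of_degree_eq_one k z (IsAlgClosed.degree_eq_one_of_irreducible k
    (minpoly.irreducible hz.isIntegral))
  exact this

lemma not_dvd_X_sub_C_and_dvd_X_sub_C {f : MvPolynomial (Fin 2) k} (hf : Irreducible f)
    (c₁ c₂ : k) : ¬ (f ∣ X 0 - C c₁ ∧ f ∣ X 1 - C c₂) := by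
  rintro ⟨⟨g, hg⟩, h⟩
  have hne : (X 0 - C c₁ : MvPolynomial (Fin 2) k) ≠ 0 := fun h0 ↦ by
    simpa using congr(eval ![c₁ + 1, 0] $h0)
  have hg0 : g ≠ 0 := by rintro rfl; simp [hne] at hg
  have hdeg := congr(totalDegree $hg)
  rw [totalDegree_mul_of_isDomain hf.ne_zero hg0] at hdeg
  have h1 : (X 0 - C c₁ : MvPolynomial (Fin 2) k).totalDegree ≤ 1 := by
    refine (totalDegree_sub _ _).trans ?_
    simp
  have hfdeg : f.totalDegree ≠ 0 := fun h0 ↦ hf.not_isUnit <| by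
    rw [totalDegree_eq_zero_iff_eq_C] at h0
    rw [h0] at hf ⊢
    exact (IsUnit.mk0 _ (by simpa using hf.ne_zero)).map C
  have hgdeg : g.totalDegree = 0 := by omega
  rw [totalDegree_eq_zero_iff_eq_C] at hgdeg
  obtain ⟨γ, rfl⟩ : ∃ γ, g = C γ := ⟨_, hgdeg⟩
  have hγ : γ ≠ 0 := by simpa using hg0
  have hfz : eval ![c₁, c₂ + 1] f = 0 := by
    simpa [hγ] using congr(eval ![c₁, c₂ + 1] $hg)
  obtain ⟨h', hh'⟩ := h
  simpa [hfz] using congr(eval ![c₁, c₂ + 1] $hh')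

/-- If a nontrivial monomial is constant at the generic point of an irreducible plane curve, then
the curve is a translate of a subtorus. -/
lemma exists_forall_eval_eq_zero_iff_of_generic [IsAlgClosed k] {f : MvPolynomial (Fin 2) k}
    (hf : Irreducible f) {L : Type v} [Field L] [Algebra k L] {ξ η : L}
    (hgen : ∀ g : MvPolynomial (Fin 2) k, aeval ![ξ, η] g = 0 ↔ f ∣ g)
    (hξ : ξ ≠ 0) (hη : η ≠ 0) {a b : ℤ} (hab : ¬ (a = 0 ∧ b = 0))
    (hc : ξ ^ a * η ^ b ∈ Set.range (algebraMap k L)) :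
    ∃ (a b : ℤ) (c : k), ¬ (a = 0 ∧ b = 0) ∧ c ≠ 0 ∧
      ∀ x y : k, x ≠ 0 → y ≠ 0 → (eval ![x, y] f = 0 ↔ x ^ a * y ^ b = c) := by
  have hd : 0 < Int.gcd a b := Int.gcd_pos_iff.mpr (by tauto)
  obtain ⟨a', b', hcop, ha, hb⟩ := Int.exists_gcd_one hd
  set d := Int.gcd a b
  obtain ⟨c, hc⟩ : ξ ^ a' * η ^ b' ∈ Set.range (algebraMap k L) := by
    refine (IsAlgebraic.of_pow hd ?_).mem_range_algebraMap_of_isAlgClosed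
    obtain ⟨c₀, hc₀⟩ := hc
    have : (ξ ^ a' * η ^ b') ^ d = algebraMap k L c₀ := by
      rw [hc₀, ha, hb, mul_pow, zpow_mul, zpow_mul, zpow_natCast, zpow_natCast]
    rw [this]
    exact isAlgebraic_algebraMap c₀
  have hc0 : c ≠ 0 := by
    rintro rfl
    simp [hξ, hη, zpow_ne_zero] at hc
  obtain ⟨r, s, hrs⟩ := Int.isCoprime_iff_gcd_eq_one.mpr hcop
  have param {M : Type v} [Field M] [Algebra k M] {x y : M} (hx : x ≠ 0) (hy : y ≠ 0)
      (h : algebraMap k M c = x ^ a' * y ^ b') :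
      (fun i : Fin 2 ↦ algebraMap k M (![c ^ r, c ^ s] i) * (x ^ (-s) * y ^ r) ^ (![-b', a'] i) *
        1 ^ (![0, 0] i : ℤ)) = ![x, y] := by
    have h₁ : x ^ (-s * -b') * x ^ (a' * r) = x := by
      rw [← zpow_add₀ hx, show -s * -b' + a' * r = 1 by linarith, zpow_one]
    have h₂ : y ^ (r * -b') * y ^ (b' * r) = 1 := by
      rw [← zpow_add₀ hy, show r * -b' + b' * r = 0 by ring, zpow_zero]
    have h₃ : x ^ (-s * a') * x ^ (a' * s) = 1 := by
      rw [← zpow_add₀ hx, show -s * a' + a' * s = 0 by ring, zpow_zero]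
    have h₄ : y ^ (r * a') * y ^ (b' * s) = y := by
      rw [← zpow_add₀ hy, show r * a' + b' * s = 1 by linarith, zpow_one]
    ext i
    fin_cases i
    · simp only [Fin.zero_eta, Matrix.cons_val_zero, map_zpow₀, h, mul_zpow, ← zpow_mul, one_zpow]
      linear_combination (y ^ (r * -b') * y ^ (b' * r)) * h₁ + x * h₂
    · simp only [Fin.mk_one, Matrix.cons_val_one, Matrix.cons_val_zero, map_zpow₀, h, mul_zpow,
        ← zpow_mul, one_zpow]
      linear_combination (y ^ (r * a') * y ^ (b' * s)) * h₃ + h₄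
  have hξη := param hξ hη hc
  have hz0 : ξ ^ (-s) * η ^ r ≠ 0 := mul_ne_zero (zpow_ne_zero _ hξ) (zpow_ne_zero _ hη)
  have hz : Transcendental k (ξ ^ (-s) * η ^ r) := by
    intro hz
    obtain ⟨ζ, hζ⟩ := hz.mem_range_algebraMap_of_isAlgClosed
    rw [← hζ] at hξη
    refine not_dvd_X_sub_C_and_dvd_X_sub_C hf (c ^ r * ζ ^ (-b')) (c ^ s * ζ ^ a')
      ⟨(hgen _).mp ?_, (hgen _).mp ?_⟩
    · simpa [sub_eq_zero] using congr($hξη 0).symm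
    · simpa [sub_eq_zero] using congr($hξη 1).symm
  refine ⟨a', b', c, ?_, hc0, fun x y hx hy ↦ ⟨fun hxy ↦ ?_, fun hxy ↦ ?_⟩⟩
  · rintro ⟨rfl, rfl⟩
    simp at hrs
  · have := aeval_laurent_eq_zero_of_generic (fun g ↦ (hgen g).mp) hξ hη (X 0 - C c) (fun _ ↦ a')
      (fun _ ↦ b') (by simp [← hc]) hx hy hxy
    simpa [sub_eq_zero] using this
  · obtain ⟨H, e, hH⟩ := exists_aeval_eq_mul_aeval_laurent f ![c ^ r, c ^ s] ![-b', a'] ![0, 0]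
    have hHz := hH L _ 1 hz0 one_ne_zero
    rw [hξη, (hgen f).mpr dvd_rfl, mul_zero] at hHz
    let h : Polynomial k := aeval ![Polynomial.X, 1] H
    have haev {M : Type v} [Field M] [Algebra k M] (t : M) :
        Polynomial.aeval t h = aeval ![t, 1] H := by
      have : (Polynomial.aeval (R := k) t).comp (aeval ![Polynomial.X, 1]) = aeval ![t, 1] := by
        ext i
        fin_cases i <;> simp
      exact congr($this H)
    rw [← haev] at hHz
    have hh : h = 0 := transcendental_iff.mp hz _ hHz
    have hHt := hH k (x ^ (-s) * y ^ r) 1 (mul_ne_zero (zpow_ne_zero _ hx) (zpow_ne_zero _ hy))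
      one_ne_zero
    rw [param hx hy hxy.symm, ← haev, hh, map_zero] at hHt
    have hne : x ^ (-s) * y ^ r ≠ 0 := mul_ne_zero (zpow_ne_zero _ hx) (zpow_ne_zero _ hy)
    rw [mul_one, zero_eq_mul, aeval_eq_eval] at hHt
    exact hHt.resolve_left (pow_ne_zero _ hne)

end LaurentMonomials

section PlaneCurves

open scoped IntermediateField

universe v
variable {k : Type v} [Field k]

lemma MvPolynomial.aeval_equivMvPolynomial {A : Type*} [CommRing A] [Algebra k A]
    (x y : A) (G : Polynomial (Polynomial k)) :
    aeval ![x, y] (Polynomial.Bivariate.equivMvPolynomial k G) = G.aevalAeval x y := by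
  have : (aeval (R := k) ![x, y]).comp
        (Polynomial.Bivariate.equivMvPolynomial k).toAlgHom =
      Polynomial.aevalAeval x y := by
    ext <;> simp
  exact congr($this G)

lemma exists_natDegree_le_forall_evalEval_eq_zero [IsAlgClosed k] {f : MvPolynomial (Fin 2) k}
    (hf : Irreducible f) (hnt : ∀ (a b : ℤ) (c : k), ¬ (a = 0 ∧ b = 0) → c ≠ 0 →
      ¬ ∀ x y : k, x ≠ 0 → y ≠ 0 → (eval ![x, y] f = 0 ↔ x ^ a * y ^ b = c)) :
    ∃ D : ℕ, ∀ a b : ℤ, ¬ (a = 0 ∧ b = 0) → ∃ G₁ G₂ : Polynomial (Polynomial k),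
      (G₁.natDegree ≤ D ∧ G₂.natDegree ≤ D) ∧
      (∀ u, G₁.eval (Polynomial.C u) ≠ 0 ∧ G₂.eval (Polynomial.C u) ≠ 0) ∧
      ∀ x y : k, x ≠ 0 → y ≠ 0 → eval ![x, y] f = 0 →
        G₁.evalEval x (x ^ a * y ^ b) = 0 ∧ G₂.evalEval y (x ^ a * y ^ b) = 0 := by
  obtain ⟨L, _, _, ξ, η, hgen⟩ := exists_irreducible_generic_point hf
  by_cases hξη : ξ = 0 ∨ η = 0
  · refine ⟨0, fun a b _ ↦ ⟨1, 1, by simp, by simp, fun x y hx hy hxy ↦ ?_⟩⟩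
    exfalso
    rcases hξη with h | h
    · obtain ⟨g, hg⟩ := (hgen (X 0)).mp (by simpa using h)
      simpa [hxy, hx] using congr(eval ![x, y] $hg)
    · obtain ⟨g, hg⟩ := (hgen (X 1)).mp (by simpa using h)
      simpa [hxy, hy] using congr(eval ![x, y] $hg)
  obtain ⟨hξ, hη⟩ := not_or.mp hξη
  have hconst (a b : ℤ) (hab : ¬ (a = 0 ∧ b = 0)) :
      ξ ^ a * η ^ b ∉ Set.range (algebraMap k L) := fun hc ↦ by
    obtain ⟨a', b', c, hab', hc', h⟩ :=
      exists_forall_eval_eq_zero_iff_of_generic hf hgen hξ hη hab hc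
    exact hnt a' b' c hab' hc' h
  have hξt : Transcendental k ξ := fun h ↦
    hconst 1 0 (by simp) (by simpa using h.mem_range_algebraMap_of_isAlgClosed)
  have hηt : Transcendental k η := fun h ↦
    hconst 0 1 (by simp) (by simpa using h.mem_range_algebraMap_of_isAlgClosed)
  obtain ⟨F, rfl⟩ := (Polynomial.Bivariate.equivMvPolynomial k).surjective f
  have hF : F ≠ 0 := by
    rintro rfl
    simp at hf
  have hFξη : F.aevalAeval ξ η = 0 := by
    rw [← MvPolynomial.aeval_equivMvPolynomial, hgen]
  have hFs : (Polynomial.Bivariate.swap F).aevalAeval η ξ = 0 := by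
    rw [Polynomial.Bivariate.aevalAeval_swap, hFξη]
  have hmem (a b : ℤ) : ξ ^ a * η ^ b ∈ (k⟮ξ⟯)⟮η⟯ :=
    mul_mem (zpow_mem (IntermediateField.algebraMap_mem _
      (⟨ξ, IntermediateField.mem_adjoin_simple_self k ξ⟩ : k⟮ξ⟯)) _)
      (zpow_mem (IntermediateField.mem_adjoin_simple_self _ η) _)
  have hmem' (a b : ℤ) : ξ ^ a * η ^ b ∈ (k⟮η⟯)⟮ξ⟯ :=
    mul_mem (zpow_mem (IntermediateField.mem_adjoin_simple_self _ ξ) _)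
      (zpow_mem (IntermediateField.algebraMap_mem _
        (⟨η, IntermediateField.mem_adjoin_simple_self k η⟩ : k⟮η⟯)) _)
  have transfer (G : Polynomial (Polynomial k)) (i j a b : ℤ)
      (hG : G.aevalAeval (ξ ^ i * η ^ j) (ξ ^ a * η ^ b) = 0) {x y : k} (hx : x ≠ 0) (hy : y ≠ 0)
      (hxy : eval ![x, y] (Polynomial.Bivariate.equivMvPolynomial k F) = 0) :
      G.evalEval (x ^ i * y ^ j) (x ^ a * y ^ b) = 0 := by
    have hvec {M : Type v} [Field M] (x y : M) :
        (fun m ↦ x ^ ![i, a] m * y ^ ![j, b] m) = ![x ^ i * y ^ j, x ^ a * y ^ b] := by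
      ext m
      fin_cases m <;> rfl
    have := aeval_laurent_eq_zero_of_generic (fun g ↦ (hgen g).mp) hξ hη
      (Polynomial.Bivariate.equivMvPolynomial k G) ![i, a] ![j, b]
      (by rw [hvec, MvPolynomial.aeval_equivMvPolynomial, hG]) hx hy hxy
    rwa [hvec, ← aeval_eq_eval, MvPolynomial.aeval_equivMvPolynomial,
      Polynomial.coe_aevalAeval_eq_evalEval] at this
  refine ⟨max F.natDegree (Polynomial.Bivariate.swap F).natDegree, fun a b hab ↦ ?_⟩
  obtain ⟨G₁, hd₁, h₁, hG₁⟩ := exists_natDegree_le_aevalAeval_eq_zero_forall_eval_ne_zero hξt hF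
    hFξη (hmem a b) (hconst a b hab)
  obtain ⟨G₂, hd₂, h₂, hG₂⟩ := exists_natDegree_le_aevalAeval_eq_zero_forall_eval_ne_zero hηt
    (by simpa using hF) hFs (hmem' a b) (hconst a b hab)
  refine ⟨G₁, G₂, ⟨le_max_of_le_left hd₁, le_max_of_le_right hd₂⟩, fun u ↦ ⟨hG₁ u, hG₂ u⟩,
    fun x y hx hy hxy ↦ ⟨?_, ?_⟩⟩
  · simpa using transfer G₁ 1 0 a b (by simpa using h₁) hx hy hxy
  · simpa using transfer G₂ 0 1 a b (by simpa using h₂) hx hy hxy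

end PlaneCurves

lemma finite_setOf_mem_curve_and_zpow_mul_zpow_eq {k : Type*} [Field k]
    {G₁ G₂ : Polynomial (Polynomial k)} {S : Set (k × k)} {u : k}
    (h₁ : G₁.eval (Polynomial.C u) ≠ 0) (h₂ : G₂.eval (Polynomial.C u) ≠ 0)
    (hS : ∀ P ∈ S, G₁.evalEval P.1 u = 0 ∧ G₂.evalEval P.2 u = 0) : S.Finite :=
  ((Polynomial.finite_setOfPred_isRoot h₁).prod (Polynomial.finite_setOfPred_isRoot h₂)).subset hS

instance : Algebra.IsAlgebraic ℚ Qbar := by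
  convert! AlgebraicClosure.isAlgebraic ℚ

/-- **Theorem (finiteness of `C^{1}`).**
Let `f ∈ Qbar[X,Y]` be irreducible, defining a curve `C` in `G_m²` which is not a translate of
a subtorus.  Then the union over all coprime `(p,q) ≠ (0,0)` of the singular intersections
`C ∩_sing H_{p,q}` — i.e. the set of smooth points `(x,y)` of `C` lying on some `H_{p,q}` with
coinciding tangent lines — is finite. -/
theorem finiteness_of_singular_intersections_with_subtori
    (f : MvPolynomial (Fin 2) Qbar) (hirr : Irreducible f)
    (hnt : ¬ IsSubtorusTranslate (curve f)) :
    {P : Qbar × Qbar | P.1 ≠ 0 ∧ P.2 ≠ 0 ∧ MvPolynomial.eval ![P.1, P.2] f = 0 ∧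
      ¬(MvPolynomial.eval ![P.1, P.2] (MvPolynomial.pderiv 0 f) = 0 ∧
        MvPolynomial.eval ![P.1, P.2] (MvPolynomial.pderiv 1 f) = 0) ∧
      ∃ p q : ℤ, IsCoprime p q ∧ ¬(p = 0 ∧ q = 0) ∧ P.1 ^ p * P.2 ^ q = 1 ∧
        (p : Qbar) * P.2 * MvPolynomial.eval ![P.1, P.2] (MvPolynomial.pderiv 1 f)
          = (q : Qbar) * P.1 * MvPolynomial.eval ![P.1, P.2] (MvPolynomial.pderiv 0 f)}.Finite := by
  obtain ⟨D, hD⟩ := exists_natDegree_le_forall_evalEval_eq_zero hirr fun a b c hab hc h ↦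
    hnt ⟨a, b, c, hab, hc, Set.ext fun P ↦
      and_congr_right fun hx ↦ and_congr_right fun hy ↦ h P.1 P.2 hx hy⟩
  obtain ⟨B, hB0, hB⟩ := exists_eventually_logHeight₁_le_of_zpow_mul_zpow_eq_one (curve f) D
    fun a b hab ↦ by
      obtain ⟨G₁, G₂, ⟨hd₁, hd₂⟩, hG, hGC⟩ := hD a b hab
      obtain ⟨C₁, hC₁, h₁⟩ :=
        exists_eventually_logHeight₁_le_of_evalEval_eq_zero G₁ fun u ↦ (hG u).1
      obtain ⟨C₂, hC₂, h₂⟩ :=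
        exists_eventually_logHeight₁_le_of_evalEval_eq_zero G₂ fun u ↦ (hG u).2
      refine ⟨C₁ + C₂, add_nonneg hC₁ hC₂, ?_⟩
      filter_upwards [h₁, h₂] with K h₁ h₂ x y hx hy ⟨hx', hy', hxy⟩
      obtain ⟨e₁, e₂⟩ := hGC x y hx' hy' hxy
      have hu := Height.zero_le_logHeight₁ (x ^ a * y ^ b)
      have ht : (0 : ℝ) ≤ Height.totalWeight K.1 := by positivity
      have i₁ := h₁ x (x ^ a * y ^ b) (by rwa [NumberSubfield.coe_zpow_mul_zpow])
      have i₂ := h₂ y (x ^ a * y ^ b) (by rwa [NumberSubfield.coe_zpow_mul_zpow])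
      have j₁ : (G₁.natDegree : ℝ) * Height.logHeight₁ (x ^ a * y ^ b) ≤
          D * Height.logHeight₁ (x ^ a * y ^ b) := by gcongr
      have j₂ : (G₂.natDegree : ℝ) * Height.logHeight₁ (x ^ a * y ^ b) ≤
          D * Height.logHeight₁ (x ^ a * y ^ b) := by gcongr
      have k₁ := mul_nonneg hC₁ ht
      have k₂ := mul_nonneg hC₂ ht
      constructor <;> linarith
  obtain ⟨M, hM⟩ := exists_eventually_abs_le_of_mul_eval_eq (X 0 * pderiv 0 f) (X 1 * pderiv 1 f)
    hB0
  let box : Finset (ℤ × ℤ) := (Finset.Icc (-⌊M⌋) ⌊M⌋ ×ˢ Finset.Icc (-⌊M⌋) ⌊M⌋).filter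
    fun pq ↦ ¬ (pq.1 = 0 ∧ pq.2 = 0)
  have hfin : ∀ pq ∈ box, {P : Qbar × Qbar | P ∈ curve f ∧ P.1 ^ pq.1 * P.2 ^ pq.2 = 1}.Finite := by
    intro pq hpq
    obtain ⟨G₁, G₂, -, hG, hGC⟩ := hD pq.1 pq.2 (Finset.mem_filter.mp hpq).2
    refine finite_setOf_mem_curve_and_zpow_mul_zpow_eq (hG 1).1 (hG 1).2 ?_
    rintro P ⟨⟨hx, hy, hxy⟩, h1⟩
    simpa only [h1] using hGC P.1 P.2 hx hy hxy
  refine (Set.Finite.biUnion box.finite_toSet hfin).subset ?_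
  rintro ⟨x, y⟩ ⟨hx, hy, hxy, hsm, p, q, hpq, hpq0, h1, htan⟩
  dsimp only at hx hy hxy hsm h1 htan
  obtain ⟨K, hBK, hMK, hxK, hyK⟩ := (hB.and (hM.and ((NumberSubfield.eventually_mem x).and
    (NumberSubfield.eventually_mem y)))).exists
  have hx0 : (⟨x, hxK⟩ : K.1) ≠ 0 := fun h ↦ hx congr(($h : Qbar))
  have hy0 : (⟨y, hyK⟩ : K.1) ≠ 0 := fun h ↦ hy congr(($h : Qbar))
  obtain ⟨hhx, hhy⟩ := hBK ⟨x, hxK⟩ ⟨y, hyK⟩ hx0 hy0 ⟨hx, hy, hxy⟩ p q hpq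
    (Subtype.val_injective ((NumberSubfield.coe_zpow_mul_zpow ..).trans h1))
  have hle := hMK ⟨x, hxK⟩ ⟨y, hyK⟩ hhx hhy (by simpa [hx, hy] using hsm) p q hpq
    (by simpa [mul_assoc] using htan)
  have hp : |p| ≤ ⌊M⌋ := Int.le_floor.mpr (by push_cast; exact (le_max_left _ _).trans hle)
  have hq : |q| ≤ ⌊M⌋ := Int.le_floor.mpr (by push_cast; exact (le_max_right _ _).trans hle)
  refine Set.mem_biUnion (x := (p, q)) ?_ ⟨⟨hx, hy, hxy⟩, h1⟩
  simp only [box, Finset.coe_filter, Finset.mem_product, Finset.mem_Icc, ← abs_le,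
    Set.mem_ofPred_eq]
  exact ⟨⟨hp, hq⟩, hpq0⟩
end

section
/- Let f ∈ Q̄[X,Y] be an irreducible polynomial defining the curve C = {(x,y) ∈ (Q̄^×)² : f(x,y)=0}, and assume C is not a torsion variety, i.e. there is no (a,b) ∈ ℤ² ∖ {(0,0)} and no root of unity ω such that C = {(x,y) ∈ (Q̄^×)² : x^a y^b = ω}. Then the set C^{1,tor} = {(x,y) ∈ (Q̄^×)² : f(x,y)=0, ((∂f/∂X)(x,y), (∂f/∂Y)(x,y)) ≠ (0,0), and there exist coprime integers (p,q) ≠ (0,0) and a root of unity ω with x^p y^q = ω and p·y·(∂f/∂Y)(x,y) = q·x·(∂f/∂X)(x,y)} is finite. (C^{1,tor} is the union of all singular intersections of C with 1-dimensional torsion subvarieties ζH_{p,q} of G_m².) -/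
open NumberField IsDedekindDomain MvPolynomial
open scoped Classical

/-- A subset `C` of the torus `G_m²` is a torsion variety if it is a translate of a subtorus by
a torsion point, i.e. of the form `{(x,y) : x^a y^b = ω}` for some `(a,b) ∈ ℤ² \ {(0,0)}` and
some root of unity `ω`. -/
def IsTorsionVariety (C : Set (Qbar × Qbar)) : Prop :=
  ∃ (a b : ℤ) (ω : Qbar), ¬(a = 0 ∧ b = 0) ∧ (∃ n : ℕ, 0 < n ∧ ω ^ n = 1) ∧
    C = {P | P.1 ≠ 0 ∧ P.2 ≠ 0 ∧ P.1 ^ a * P.2 ^ b = ω}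

namespace PlaceSum

open Height AdmissibleAbsValues Real

section PlaceSums

variable {K : Type*} [Field K]

/-- `SumBound v N M` says that a sum of at most `N` terms is bounded, for the absolute value `v`, by
`M` times the largest term. -/
def SumBound (v : AbsoluteValue K ℝ) (N : ℕ) (M : ℝ) : Prop :=
  1 ≤ M ∧ ∀ {ι : Type} (s : Finset ι) (u : ι → K) (B : ℝ), s.card ≤ N → 0 ≤ B →
    (∀ i ∈ s, v (u i) ≤ B) → v (∑ i ∈ s, u i) ≤ M * B

lemma sumBound_natCast (v : AbsoluteValue K ℝ) {N : ℕ} (hN : 1 ≤ N) : SumBound v N N := by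
  refine ⟨by exact_mod_cast hN, fun s u B hs hB h ↦ ?_⟩
  calc v (∑ i ∈ s, u i) ≤ ∑ i ∈ s, v (u i) := v.sum_le _ _
    _ ≤ ∑ i ∈ s, B := Finset.sum_le_sum h
    _ = s.card * B := by simp
    _ ≤ N * B := by gcongr

lemma sumBound_one_of_isNonarchimedean {v : AbsoluteValue K ℝ} (hv : IsNonarchimedean v) (N : ℕ) :
    SumBound v N 1 := by
  refine ⟨le_rfl, fun s u B _ hB h ↦ ?_⟩
  rw [one_mul]
  refine (IsNonarchimedean.apply_sum_le hv).trans ?_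
  exact Real.iSup_le (fun i ↦ h i i.2) hB

/-- Two terms of a vanishing sum have nearly the same absolute value. -/
lemma SumBound.exists_abs_log_sub_le {v : AbsoluteValue K ℝ} {N : ℕ} {M : ℝ} (hv : SumBound v N M)
    {ι : Type} {s : Finset ι} (hs : s.Nonempty) (hN : s.card ≤ N) {u : ι → K}
    (hu : ∀ i ∈ s, u i ≠ 0) (h : ∑ i ∈ s, u i = 0) :
    ∃ i ∈ s, ∃ j ∈ s, i ≠ j ∧ |log (v (u i)) - log (v (u j))| ≤ log M := by
  classical
  obtain ⟨i, hi, hmax⟩ := s.exists_max_image (fun i ↦ v (u i)) hs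
  have hsum : u i = -∑ j ∈ s.erase i, u j := by
    rw [← Finset.add_sum_erase s u hi] at h
    exact eq_neg_of_add_eq_zero_left h
  have hne : (s.erase i).Nonempty := by
    by_contra hne
    rw [Finset.not_nonempty_iff_eq_empty] at hne
    exact hu i hi (by simpa [hne] using hsum)
  obtain ⟨j, hj, hmax'⟩ := (s.erase i).exists_max_image (fun i ↦ v (u i)) hne
  obtain ⟨hji, hjs⟩ := Finset.mem_erase.mp hj
  refine ⟨i, hi, j, hjs, hji.symm, ?_⟩
  have h1 : v (u i) ≤ M * v (u j) := by
    rw [hsum, v.map_neg]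
    exact hv.2 _ _ _ ((Finset.card_le_card (Finset.erase_subset _ _)).trans hN) (v.nonneg _) hmax'
  have hpi := v.pos (hu i hi)
  have hpj := v.pos (hu j hjs)
  have hM : 0 < M := one_pos.trans_le hv.1
  have h2 := log_le_log hpi h1
  rw [log_mul hM.ne' hpj.ne'] at h2
  have h3 := log_le_log hpj (hmax j hjs)
  rw [abs_of_nonneg (by linarith)]
  linarith

lemma SumBound.posLog_sum_le {v : AbsoluteValue K ℝ} {N : ℕ} {M : ℝ} (hv : SumBound v N M)
    {ι : Type} {s : Finset ι} (hN : s.card ≤ N) {u : ι → K} {E : ℝ} (hE : 0 ≤ E)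
    (h : ∀ i ∈ s, log⁺ (v (u i)) ≤ E) : log⁺ (v (∑ i ∈ s, u i)) ≤ log M + E := by
  have hM : 0 < M := one_pos.trans_le hv.1
  have h1 : v (∑ i ∈ s, u i) ≤ M * exp E := by
    refine hv.2 s u (exp E) hN (exp_pos _).le fun i hi ↦ ?_
    rcases (v.nonneg (u i)).eq_or_lt with h0 | h0
    · rw [← h0]; exact (exp_pos _).le
    · rw [← log_le_iff_le_exp h0]
      exact (le_max_right _ _).trans (h i hi)
  have h2 : log (M * exp E) = log M + E := by
    rw [log_mul hM.ne' (exp_ne_zero _), log_exp]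
  rw [← h2]
  refine (posLog_le_posLog (v.nonneg _) h1).trans_eq (posLog_eq_log ?_)
  rw [abs_of_pos (by positivity)]
  exact one_le_mul_of_one_le_of_one_le hv.1 (one_le_exp hE)

/-- A bound for the absolute value of a root of a Laurent polynomial. -/
lemma SumBound.posLog_root_le {v : AbsoluteValue K ℝ} {N : ℕ} {M : ℝ} (hv : SumBound v N M)
    {s : Finset ℤ} (hN : s.card ≤ N) {A : ℤ → K} {w : K} (hw : w ≠ 0)
    (h : ∑ k ∈ s, A k * w ^ k = 0) {n : ℤ} (hn : n ∈ s) (hAn : A n ≠ 0)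
    (htop : ∀ k ∈ s, n < k → A k = 0) {E : ℝ} (hE : ∀ k ∈ s, log⁺ (v (A k)) ≤ E) :
    log⁺ (v w) ≤ log M + E - log (v (A n)) := by
  have hM : 0 < M := one_pos.trans_le hv.1
  have hpw := v.pos hw
  have hpA := v.pos hAn
  have hAnE : log (v (A n)) ≤ E := (le_max_right _ _).trans (hE n hn)
  have hM0 : 0 ≤ log M := log_nonneg hv.1
  rcases le_or_gt (v w) 1 with hle | hlt
  · rw [(posLog_eq_zero_iff _).mpr (by rwa [abs_of_pos hpw])]
    linarith
  rw [posLog_eq_log (by rw [abs_of_pos hpw]; exact hlt.le)]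
  have hsum : A n * w ^ n = -∑ k ∈ s.erase n, A k * w ^ k := by
    rw [← Finset.add_sum_erase s _ hn] at h
    exact eq_neg_of_add_eq_zero_left h
  have h1 : v (A n * w ^ n) ≤ M * (exp E * v w ^ (n - 1)) := by
    rw [hsum, v.map_neg]
    refine hv.2 _ _ _ ((Finset.card_le_card (Finset.erase_subset _ _)).trans hN)
      (by positivity) fun k hk ↦ ?_
    obtain ⟨hkn, hks⟩ := Finset.mem_erase.mp hk
    rcases lt_or_gt_of_ne hkn with hk' | hk'
    · rw [map_mul, map_zpow₀]
      refine mul_le_mul ?_ (zpow_le_zpow_right₀ hlt.le (by lia)) (by positivity) (exp_pos _).le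
      rcases (v.nonneg (A k)).eq_or_lt with h0 | h0
      · rw [← h0]; exact (exp_pos _).le
      · rw [← log_le_iff_le_exp h0]
        exact (le_max_right _ _).trans (hE k hks)
    · rw [htop k hks hk', zero_mul, map_zero]
      positivity
  rw [map_mul, map_zpow₀] at h1
  have h2 := log_le_log (by positivity) h1
  rw [log_mul hpA.ne' (by positivity), log_mul hM.ne' (by positivity),
    log_mul (exp_ne_zero _) (by positivity), log_exp, log_zpow, log_zpow] at h2
  push_cast at h2
  linarith

/-- `HasPlaceSum F H` says that the sum of the local terms `F v` over all places `v` of `K` is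
finitely supported away from the archimedean places and has value `H`. -/
def HasPlaceSum {K : Type*} [Field K] [AdmissibleAbsValues K] (F : AbsoluteValue K ℝ → ℝ) (H : ℝ) :
    Prop :=
  (Function.support fun v : nonarchAbsVal (K := K) ↦ F v.val).Finite ∧
    (archAbsVal.map F).sum + ∑ᶠ v : nonarchAbsVal (K := K), F v.val = H

variable [AdmissibleAbsValues K]

lemma HasPlaceSum.add {F G : AbsoluteValue K ℝ → ℝ} {A B : ℝ} (hF : HasPlaceSum F A)
    (hG : HasPlaceSum G B) : HasPlaceSum (fun v ↦ F v + G v) (A + B) := by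
  refine ⟨(hF.1.union hG.1).subset (Function.support_add _ _), ?_⟩
  rw [finsum_add_distrib hF.1 hG.1, Multiset.sum_map_add, ← hF.2, ← hG.2]
  ring

lemma HasPlaceSum.const_mul {F : AbsoluteValue K ℝ → ℝ} {A : ℝ} (c : ℝ) (hF : HasPlaceSum F A) :
    HasPlaceSum (fun v ↦ c * F v) (c * A) := by
  refine ⟨hF.1.subset fun v hv ↦ right_ne_zero_of_mul hv, ?_⟩
  have := smul_finsum c fun v : nonarchAbsVal (K := K) ↦ F v.val
  simp only [smul_eq_mul] at this
  rw [← this, Multiset.sum_map_mul_left, ← hF.2]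
  ring

lemma hasPlaceSum_zero : HasPlaceSum (fun _ : AbsoluteValue K ℝ ↦ (0 : ℝ)) 0 := by
  simp [HasPlaceSum]

lemma HasPlaceSum.sum {ι : Type*} (s : Finset ι) {F : ι → AbsoluteValue K ℝ → ℝ} {A : ι → ℝ}
    (hF : ∀ i ∈ s, HasPlaceSum (F i) (A i)) :
    HasPlaceSum (fun v ↦ ∑ i ∈ s, F i v) (∑ i ∈ s, A i) := by
  classical
  induction s using Finset.induction_on with
  | empty => simpa using hasPlaceSum_zero
  | insert i s hi ih =>
    simp only [Finset.sum_insert hi]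
    exact (hF i (by simp)).add (ih fun j hj ↦ hF j (by simp [hj]))

lemma HasPlaceSum.le_add {F G : AbsoluteValue K ℝ → ℝ} {A B C : ℝ} (hF : HasPlaceSum F A)
    (hG : HasPlaceSum G B) (harch : ∀ v ∈ archAbsVal (K := K), F v ≤ G v + C)
    (hnonarch : ∀ v ∈ nonarchAbsVal (K := K), F v ≤ G v) : A ≤ B + C * totalWeight K := by
  have h1 := Multiset.sum_map_le_sum_map _ _ harch
  have h2 : ∑ᶠ v : nonarchAbsVal (K := K), F v.val ≤ ∑ᶠ v : nonarchAbsVal (K := K), G v.val := by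
    have hfin := hF.1.union hG.1
    have e1 := finsum_eq_sum_of_support_subset (fun v : nonarchAbsVal (K := K) ↦ F v.val)
      (s := hfin.toFinset) (by simp)
    have e2 := finsum_eq_sum_of_support_subset (fun v : nonarchAbsVal (K := K) ↦ G v.val)
      (s := hfin.toFinset) (by simp)
    rw [e1, e2]
    exact Finset.sum_le_sum fun v _ ↦ hnonarch v.val v.2
  rw [Multiset.sum_map_add, Multiset.map_const', Multiset.sum_replicate, nsmul_eq_mul] at h1
  rw [← hF.2, ← hG.2, totalWeight]
  linarith

lemma hasPlaceSum_log {x : K} (hx : x ≠ 0) : HasPlaceSum (fun v ↦ log (v x)) 0 := by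
  constructor
  · refine (hasFiniteMulSupport hx).subset fun v hv ↦ ?_
    simp only [Function.mem_support, Function.mem_mulSupport] at hv ⊢
    intro h
    simp [h] at hv
  · have h := congrArg log (product_formula hx)
    have h1 : ∀ r ∈ (archAbsVal (K := K)).map (· x), r ≠ 0 := by
      simp only [Multiset.mem_map]
      rintro _ ⟨v, _, rfl⟩
      simpa using hx
    have h2 : 0 < ∏ᶠ v : nonarchAbsVal (K := K), v.val x :=
      finprod_induction (0 < ·) one_pos (fun _ _ ↦ mul_pos) fun v ↦ v.val.pos hx
    have h3 : ((archAbsVal (K := K)).map (· x)).prod ≠ 0 := fun h0 ↦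
      h1 0 (Multiset.prod_eq_zero_iff.mp h0) rfl
    rw [log_mul h3 h2.ne', log_multiset_prod h1, Multiset.map_map,
      log_finprod fun v : nonarchAbsVal (K := K) ↦ v.val.pos hx, log_one] at h
    exact h

lemma hasPlaceSum_posLog (x : K) : HasPlaceSum (fun v ↦ log⁺ (v x)) (logHeight₁ x) := by
  refine ⟨?_, (logHeight₁_eq x).symm⟩
  rcases eq_or_ne x 0 with rfl | hx
  · simp
  · refine (hasFiniteMulSupport hx).subset fun v hv ↦ ?_
    simp only [Function.mem_support, Function.mem_mulSupport] at hv ⊢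
    intro h
    simp [h] at hv

lemma hasPlaceSum_abs_log {x : K} (hx : x ≠ 0) :
    HasPlaceSum (fun v ↦ |log (v x)|) (2 * logHeight₁ x) := by
  have h := ((hasPlaceSum_posLog x).const_mul 2).add ((hasPlaceSum_log hx).const_mul (-1))
  convert h using 2
  · rename_i v
    rw [← half_mul_log_add_log_abs]
    ring
  · ring

end PlaceSums

section RootBounds

variable {K : Type*} [Field K]

lemma posLog_mul_zpow_le (v : AbsoluteValue K ℝ) (c x : K) {n : ℤ} {D : ℕ} (hn : n.natAbs ≤ D) :
    log⁺ (v (c * x ^ n)) ≤ log⁺ (v c) + D * (log⁺ (v x) + log⁺ (v x⁻¹)) := by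
  have h0 := posLog_nonneg (x := v x)
  have h1 := posLog_nonneg (x := v x⁻¹)
  have hD : (n.natAbs : ℝ) ≤ D := by exact_mod_cast hn
  have hzpow : log⁺ (v (x ^ n)) ≤ n.natAbs * (log⁺ (v x) + log⁺ (v x⁻¹)) := by
    rcases Int.natAbs_eq n with h | h
    · rw [h, zpow_natCast, map_pow, posLog_pow, Int.natAbs_natCast]
      nlinarith [Nat.cast_nonneg (α := ℝ) n.natAbs]
    · rw [h, zpow_neg, zpow_natCast, ← inv_pow, map_pow, posLog_pow, Int.natAbs_neg,
        Int.natAbs_natCast]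
      nlinarith [Nat.cast_nonneg (α := ℝ) n.natAbs]
  rw [map_mul]
  have := posLog_mul (x := v c) (y := v (x ^ n))
  nlinarith

lemma log_add_log_of_pow_eq_one (v : AbsoluteValue K ℝ) {x y : K} (hx : x ≠ 0) (hy : y ≠ 0)
    {p q : ℤ} {n : ℕ} (hn : 0 < n) (h : (x ^ p * y ^ q) ^ n = 1) :
    p * log (v x) + q * log (v y) = 0 := by
  have h1 := congrArg (fun z ↦ log (v z)) h
  have hx' := (v.pos hx).ne'
  have hy' := (v.pos hy).ne'
  simp only [map_pow, map_mul, map_zpow₀, log_pow, map_one, log_one] at h1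
  rw [log_mul (zpow_ne_zero _ hx') (zpow_ne_zero _ hy'), log_zpow, log_zpow] at h1
  have hn' : (n : ℝ) ≠ 0 := by positivity
  exact (mul_eq_zero.mp h1).resolve_left hn'

variable [AdmissibleAbsValues K]

lemma le_add_of_sumBound {F G : AbsoluteValue K ℝ → ℝ} {A B : ℝ} (hF : HasPlaceSum F A)
    (hG : HasPlaceSum G B) {N : ℕ} (hN : 1 ≤ N) {C : ℝ}
    (h : ∀ v M, SumBound v N M → F v ≤ G v + C * log M) : A ≤ B + C * log N * totalWeight K :=
  hF.le_add hG (fun v _ ↦ h v N (sumBound_natCast v hN)) fun v hv ↦ by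
    simpa using h v 1 (sumBound_one_of_isNonarchimedean (isNonarchimedean v hv) N)

/-- The height of a root of a Laurent polynomial whose coefficients are Laurent polynomials in `x`;
the bound does not involve the degree of the equation in `w`. -/
lemma logHeight₁_root_le {ι : Type} {s : Finset ι} {a b : ι → ℤ} {c : ι → K} {x w : K}
    (hw : w ≠ 0) {D : ℕ} (hD : ∀ i ∈ s, (a i).natAbs ≤ D)
    (h : ∑ i ∈ s, c i * x ^ a i * w ^ b i = 0)
    (hnz : ∃ k, ∑ i ∈ s with b i = k, c i * x ^ a i ≠ 0) :
    logHeight₁ w ≤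
      2 * log s.card * totalWeight K + ∑ i ∈ s, logHeight₁ (c i) + 2 * D * logHeight₁ x := by
  classical
  set A : ℤ → K := fun k ↦ ∑ i ∈ s with b i = k, c i * x ^ a i with hA
  set t := s.image b with ht
  have hsum : ∑ k ∈ t, A k * w ^ k = 0 := by
    rw [← h, ← Finset.sum_fiberwise_of_maps_to (g := b) (t := t)
      (fun i hi ↦ Finset.mem_image_of_mem b hi)]
    refine Finset.sum_congr rfl fun k _ ↦ ?_
    rw [hA, Finset.sum_mul]
    refine Finset.sum_congr rfl fun i hi ↦ ?_
    rw [(Finset.mem_filter.mp hi).2]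
  have hmem : ∀ k, A k ≠ 0 → k ∈ t := by
    intro k hk
    obtain ⟨i, hi, _⟩ := Finset.exists_ne_zero_of_sum_ne_zero hk
    obtain ⟨his, rfl⟩ := Finset.mem_filter.mp hi
    exact Finset.mem_image_of_mem b his
  have hne : (t.filter fun k ↦ A k ≠ 0).Nonempty := by
    obtain ⟨k, hk⟩ := hnz
    exact ⟨k, Finset.mem_filter.mpr ⟨hmem k hk, hk⟩⟩
  obtain ⟨n, hn, hmax⟩ := (t.filter fun k ↦ A k ≠ 0).exists_max_image id hne
  obtain ⟨hnt, hAn⟩ := Finset.mem_filter.mp hn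
  have hcard : 1 ≤ s.card := by
    obtain ⟨i, hi, _⟩ := Finset.mem_image.mp hnt
    exact Finset.card_pos.mpr ⟨i, hi⟩
  have hG := ((HasPlaceSum.sum s fun i _ ↦ hasPlaceSum_posLog (c i)).add
    (((hasPlaceSum_posLog x).add (hasPlaceSum_posLog x⁻¹)).const_mul D)).add
    ((hasPlaceSum_log hAn).const_mul (-1))
  have := le_add_of_sumBound (hasPlaceSum_posLog w) hG hcard (C := 2) fun v M hv ↦ ?_
  · rw [logHeight₁_inv] at this
    linarith
  have hterm : ∀ i ∈ s, log⁺ (v (c i * x ^ a i)) ≤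
      ∑ i ∈ s, log⁺ (v (c i)) + D * (log⁺ (v x) + log⁺ (v x⁻¹)) := fun i hi ↦ by
    have h1 := Finset.single_le_sum (f := fun i ↦ log⁺ (v (c i)))
      (fun _ _ ↦ posLog_nonneg) hi
    have h2 := posLog_mul_zpow_le v (c i) x (hD i hi)
    linarith
  have hE : 0 ≤ ∑ i ∈ s, log⁺ (v (c i)) + D * (log⁺ (v x) + log⁺ (v x⁻¹)) := by
    have h0 := posLog_nonneg (x := v x)
    have h1 := posLog_nonneg (x := v x⁻¹)
    have h2 := Finset.sum_nonneg fun i (_ : i ∈ s) ↦ posLog_nonneg (x := v (c i))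
    positivity
  have := hv.posLog_root_le Finset.card_image_le hw hsum hnt hAn
    (fun k hk hnk ↦ by
      by_contra hAk
      exact absurd (hmax k (Finset.mem_filter.mpr ⟨hk, hAk⟩)) (not_le.mpr hnk))
    (fun k _ ↦ hv.posLog_sum_le (Finset.card_filter_le _ _) hE
      fun i hi ↦ hterm i (Finset.mem_filter.mp hi).1)
  linarith

/-- If `x ^ p * y ^ q` is a root of unity then the heights of `x` and `y` are proportional. -/
lemma natAbs_mul_logHeight₁_eq {x y : K} {p q : ℤ} {n : ℕ} (hn : 0 < n)
    (h : (x ^ p * y ^ q) ^ n = 1) :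
    p.natAbs * logHeight₁ x = q.natAbs * logHeight₁ y := by
  have h1 : x ^ (p * n) = y ^ (-(q * n)) := by
    rw [mul_pow, ← zpow_natCast, ← zpow_natCast, ← zpow_mul, ← zpow_mul] at h
    rw [zpow_neg]
    exact eq_inv_of_mul_eq_one_left h
  have h2 := congrArg logHeight₁ h1
  rw [logHeight₁_zpow, logHeight₁_zpow, Int.natAbs_neg, Int.natAbs_mul, Int.natAbs_mul,
    Int.natAbs_natCast] at h2
  push_cast at h2
  have hn' : (n : ℝ) ≠ 0 := by positivity
  apply mul_left_cancel₀ hn'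
  linarith

/-- Height bound for a solution whose multiplicative relation is far from the directions
determined by the exponents. -/
lemma logHeight₁_le_of_forall_le {ι : Type} {s : Finset ι} {a b : ι → ℤ} {c : ι → K} {x y : K}
    (hs : s.Nonempty) (hc : ∀ i ∈ s, c i ≠ 0) (hx : x ≠ 0) (hy : y ≠ 0)
    (h : ∑ i ∈ s, c i * x ^ a i * y ^ b i = 0) {p q : ℤ} {n : ℕ} (hn : 0 < n)
    (hpq : (x ^ p * y ^ q) ^ n = 1) {R δ : ℝ} (hδ : 0 < δ) (hR : 0 < R) (hp : |(p : ℝ)| ≤ R)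
    (hq : |(q : ℝ)| ≤ R)
    (hfar : ∀ i ∈ s, ∀ j ∈ s, i ≠ j →
      δ * R ≤ |((a i - a j) * q - (b i - b j) * p : ℤ)|) :
    logHeight₁ x ≤ δ⁻¹ * (log s.card * totalWeight K + 4 * ∑ i ∈ s, logHeight₁ (c i)) ∧
    logHeight₁ y ≤ δ⁻¹ * (log s.card * totalWeight K + 4 * ∑ i ∈ s, logHeight₁ (c i)) := by
  have hG := (HasPlaceSum.sum s fun i hi ↦ hasPlaceSum_abs_log (hc i hi)).const_mul (δ⁻¹ * 2)
  have key : ∀ v M, SumBound v s.card M →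
      |log (v x)| ≤ δ⁻¹ * 2 * (∑ i ∈ s, |log (v (c i))|) + δ⁻¹ * log M ∧
      |log (v y)| ≤ δ⁻¹ * 2 * (∑ i ∈ s, |log (v (c i))|) + δ⁻¹ * log M := by
    intro v M hv
    have hx' := (v.pos hx).ne'
    have hy' := (v.pos hy).ne'
    obtain ⟨i, hi, j, hj, hij, hle⟩ := hv.exists_abs_log_sub_le hs le_rfl
      (u := fun i ↦ c i * x ^ a i * y ^ b i)
      (fun i hi ↦ mul_ne_zero (mul_ne_zero (hc i hi) (zpow_ne_zero _ hx)) (zpow_ne_zero _ hy)) h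
    have hlog : ∀ i ∈ s, log (v (c i * x ^ a i * y ^ b i)) =
        log (v (c i)) + a i * log (v x) + b i * log (v y) := fun i hi ↦ by
      have hci := (v.pos (hc i hi)).ne'
      rw [map_mul, map_mul, map_zpow₀, map_zpow₀, log_mul (mul_ne_zero hci (zpow_ne_zero _ hx'))
        (zpow_ne_zero _ hy'), log_mul hci (zpow_ne_zero _ hx'), log_zpow, log_zpow]
    simp only [hlog i hi, hlog j hj] at hle
    have hrel := log_add_log_of_pow_eq_one v hx hy hn hpq
    have hsi := Finset.single_le_sum (f := fun i ↦ |log (v (c i))|) (fun _ _ ↦ abs_nonneg _) hi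
    have hsj := Finset.single_le_sum (f := fun i ↦ |log (v (c i))|) (fun _ _ ↦ abs_nonneg _) hj
    have hfar' := hfar i hi j hj hij
    set S := ∑ i ∈ s, |log (v (c i))|
    set ξ := log (v x)
    set η := log (v y)
    push_cast at hfar'
    set d : ℝ := a i - a j
    set e : ℝ := b i - b j
    set r : ℝ := d * ξ + e * η with hr
    have hrle : |r| ≤ 2 * S + log M := by
      have h1 : r = (log (v (c i)) + a i * ξ + b i * η - (log (v (c j)) + a j * ξ + b j * η)) -
        log (v (c i)) + log (v (c j)) := by simp only [hr, d, e]; ring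
      rw [h1]
      refine (abs_add_le _ _).trans ?_
      have := abs_sub (log (v (c i)) + a i * ξ + b i * η - (log (v (c j)) + a j * ξ + b j * η))
        (log (v (c i)))
      linarith
    have bound : ∀ u m : ℝ, |m| ≤ R → u * (d * q - e * p) = m * r →
        |u| ≤ δ⁻¹ * 2 * S + δ⁻¹ * log M := by
      intro u m hm hu
      have h1 : |u| * (δ * R) ≤ R * (2 * S + log M) := by
        calc |u| * (δ * R) ≤ |u| * |d * q - e * p| := by gcongr
          _ = |m| * |r| := by rw [← abs_mul, hu, abs_mul]
          _ ≤ R * (2 * S + log M) := by gcongr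
      have h2 : |u| * δ ≤ 2 * S + log M := by
        apply le_of_mul_le_mul_left _ hR
        linarith
      rw [show δ⁻¹ * 2 * S + δ⁻¹ * log M = (2 * S + log M) / δ by ring, le_div_iff₀ hδ]
      exact h2
    refine ⟨bound ξ q hq ?_, bound η (-p) (by rwa [abs_neg]) ?_⟩
    · linear_combination (-e) * hrel
    · linear_combination d * hrel
  have pos : ∀ r : ℝ, log⁺ r ≤ |log r| := fun r ↦ by
    rw [← half_mul_log_add_log_abs]
    linarith [le_abs_self (log r)]
  have hcard : 1 ≤ s.card := Finset.card_pos.mpr hs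
  have e1 : δ⁻¹ * 2 * ∑ i ∈ s, 2 * logHeight₁ (c i) + δ⁻¹ * log s.card * totalWeight K =
      δ⁻¹ * (log s.card * totalWeight K + 4 * ∑ i ∈ s, logHeight₁ (c i)) := by
    rw [← Finset.mul_sum]; ring
  rw [← e1]
  exact ⟨le_add_of_sumBound (hasPlaceSum_posLog x) hG hcard
      fun v M hv ↦ (pos _).trans (key v M hv).1,
    le_add_of_sumBound (hasPlaceSum_posLog y) hG hcard
      fun v M hv ↦ (pos _).trans (key v M hv).2⟩

end RootBounds

section Directions

variable {K : Type*} [Field K] [AdmissibleAbsValues K]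

/-- Height bound for a solution whose multiplicative relation is close to the direction of `x`. -/
lemma logHeight₁_le_of_mul_natAbs_le {ι : Type} {s : Finset ι} {a b : ι → ℤ} {c : ι → K} {x y : K}
    (hy : y ≠ 0) {D : ℕ} (hD : ∀ i ∈ s, (a i).natAbs ≤ D)
    (h : ∑ i ∈ s, c i * x ^ a i * y ^ b i = 0)
    (hnz : ∃ k, ∑ i ∈ s with b i = k, c i * x ^ a i ≠ 0) {p q : ℤ} {n : ℕ} (hn : 0 < n)
    (hpq : (x ^ p * y ^ q) ^ n = 1) (hp : p ≠ 0) (hqp : (4 * D + 1) * |(q : ℝ)| ≤ |(p : ℝ)|) :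
    logHeight₁ x ≤ 4 * log s.card * totalWeight K + 2 * ∑ i ∈ s, logHeight₁ (c i) ∧
    logHeight₁ y ≤ 4 * log s.card * totalWeight K + 2 * ∑ i ∈ s, logHeight₁ (c i) := by
  have h1 := logHeight₁_root_le hy hD h hnz
  have h2 := natAbs_mul_logHeight₁_eq hn hpq
  rw [Nat.cast_natAbs, Nat.cast_natAbs, Int.cast_abs, Int.cast_abs] at h2
  have hp0 : 0 < |(p : ℝ)| := by simpa using hp
  have hq0 := abs_nonneg (q : ℝ)
  have hx0 := zero_le_logHeight₁ x
  have hy0 := zero_le_logHeight₁ y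
  have h3 : (4 * D + 1) * logHeight₁ x ≤ logHeight₁ y := by
    apply le_of_mul_le_mul_left _ hp0
    nlinarith
  have hD0 : 0 ≤ (D : ℝ) * logHeight₁ x := by positivity
  constructor <;> linarith

/-- Uniform height bound for solutions whose multiplicative relation is close to the direction
`(a₀, b₀)`. -/
lemma exists_logHeight₁_le_near_direction {ι : Type} (s : Finset ι) (a b : ι → ℤ) {a₀ b₀ : ℤ}
    (hab : IsCoprime a₀ b₀) :
    ∃ ε > (0 : ℝ), ∃ C : ℝ, 0 ≤ C ∧ ∀ (K : Type) [Field K] [AdmissibleAbsValues K] (c : ι → K)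
      (x y : K) (p q : ℤ) (n : ℕ), x ≠ 0 → y ≠ 0 → ¬ (p = 0 ∧ q = 0) → 0 < n →
      ∑ i ∈ s, c i * x ^ a i * y ^ b i = 0 → (x ^ p * y ^ q) ^ n = 1 →
      |((a₀ * q - b₀ * p : ℤ) : ℝ)| ≤ ε * max |(p : ℝ)| |(q : ℝ)| →
      (∀ k, ∑ i ∈ s with a₀ * b i - b₀ * a i = k, c i * x ^ a i * y ^ b i = 0) ∨
      (logHeight₁ x ≤ C * (totalWeight K + ∑ i ∈ s, logHeight₁ (c i)) ∧
        logHeight₁ y ≤ C * (totalWeight K + ∑ i ∈ s, logHeight₁ (c i))) := by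
  obtain ⟨r, t, hrt⟩ := hab
  set D : ℕ := s.sup fun i ↦ (r * a i + t * b i).natAbs
  have hD : ∀ i ∈ s, (r * a i + t * b i).natAbs ≤ D := fun i hi ↦
    Finset.le_sup (f := fun i ↦ (r * a i + t * b i).natAbs) hi
  set m : ℝ := |(a₀ : ℝ)| + |(b₀ : ℝ)| + |(r : ℝ)| + |(t : ℝ)| + 1 with hm
  have ha0 := abs_nonneg (a₀ : ℝ)
  have hb0 := abs_nonneg (b₀ : ℝ)
  have hr0 := abs_nonneg (r : ℝ)
  have ht0 := abs_nonneg (t : ℝ)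
  have hm0 : 0 < m := by linarith
  have hlog : 0 ≤ log (s.card : ℝ) := log_natCast_nonneg _
  refine ⟨(m * (4 * D + 2))⁻¹, by positivity, m * (4 * log s.card + 2), by positivity, ?_⟩
  intro K _ _ c x y p q n hx hy hpq0 hn hsum hpq hclose
  set z := x ^ a₀ * y ^ b₀ with hz
  set w := x ^ (-t) * y ^ r with hw
  have hw0 : w ≠ 0 := mul_ne_zero (zpow_ne_zero _ hx) (zpow_ne_zero _ hy)
  have mono : ∀ u v : ℤ, z ^ (r * u + t * v) * w ^ (a₀ * v - b₀ * u) = x ^ u * y ^ v := by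
    intro u v
    rw [hz, hw, mul_zpow, mul_zpow, ← zpow_mul, ← zpow_mul, ← zpow_mul, ← zpow_mul,
      mul_mul_mul_comm, ← zpow_add₀ hx, ← zpow_add₀ hy]
    congr 2
    · linear_combination u * hrt
    · linear_combination v * hrt
  have hsum' : ∑ i ∈ s, c i * z ^ (r * a i + t * b i) * w ^ (a₀ * b i - b₀ * a i) = 0 := by
    rw [← hsum]
    exact Finset.sum_congr rfl fun i _ ↦ by rw [mul_assoc, mono, mul_assoc]
  by_cases hnz : ∃ k, ∑ i ∈ s with a₀ * b i - b₀ * a i = k, c i * z ^ (r * a i + t * b i) ≠ 0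
  swap
  · left
    intro k
    push Not at hnz
    rw [← zero_mul (w ^ k), ← hnz k, Finset.sum_mul]
    refine Finset.sum_congr rfl fun i hi ↦ ?_
    rw [← (Finset.mem_filter.mp hi).2, mul_assoc, mul_assoc, mono]
  right
  set p' := r * p + t * q with hp'
  set q' := a₀ * q - b₀ * p with hq'
  have hp_eq : p = a₀ * p' - t * q' := by rw [hp', hq']; linear_combination (-p) * hrt
  have hq_eq : q = b₀ * p' + r * q' := by rw [hp', hq']; linear_combination (-q) * hrt
  have hpq' : (z ^ p' * w ^ q') ^ n = 1 := by rw [hp', hq', mono, hpq]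
  have hP0 := abs_nonneg (p' : ℝ)
  have hQ0 := abs_nonneg (q' : ℝ)
  have hple : |(p : ℝ)| ≤ m * (|(p' : ℝ)| + |(q' : ℝ)|) := by
    have : (p : ℝ) = a₀ * p' - t * q' := by exact_mod_cast hp_eq
    rw [this]
    refine (abs_sub _ _).trans ?_
    rw [abs_mul, abs_mul, hm]
    nlinarith
  have hqle : |(q : ℝ)| ≤ m * (|(p' : ℝ)| + |(q' : ℝ)|) := by
    have : (q : ℝ) = b₀ * p' + r * q' := by exact_mod_cast hq_eq
    rw [this]
    refine (abs_add_le _ _).trans ?_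
    rw [abs_mul, abs_mul, hm]
    nlinarith
  have hclose' : (4 * D + 1) * |(q' : ℝ)| ≤ |(p' : ℝ)| := by
    have h1 : |(q' : ℝ)| ≤ (m * (4 * D + 2))⁻¹ * (m * (|(p' : ℝ)| + |(q' : ℝ)|)) :=
      hclose.trans (by gcongr; exact max_le hple hqle)
    rw [inv_mul_eq_div, mul_div_mul_left _ _ hm0.ne', le_div_iff₀ (by positivity)] at h1
    linarith
  have hp'0 : p' ≠ 0 := by
    intro h0
    have h1 : |(q' : ℝ)| = 0 := by
      rw [h0] at hclose'
      simp only [Int.cast_zero, abs_zero] at hclose'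
      have : 0 ≤ (D : ℝ) * |(q' : ℝ)| := by positivity
      linarith
    have h2 : q' = 0 := by simpa using h1
    exact hpq0 ⟨by rw [hp_eq, h0, h2]; ring, by rw [hq_eq, h0, h2]; ring⟩
  obtain ⟨hzle, hwle⟩ := logHeight₁_le_of_mul_natAbs_le hw0 hD hsum' hnz hn hpq' hp'0 hclose'
  have hS : 0 ≤ ∑ i ∈ s, logHeight₁ (c i) := Finset.sum_nonneg fun _ _ ↦ zero_le_logHeight₁ _
  set S := ∑ i ∈ s, logHeight₁ (c i)
  have hT : (0 : ℝ) ≤ totalWeight K := Nat.cast_nonneg _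
  have hB : 4 * log s.card * totalWeight K + 2 * S ≤
      (4 * log s.card + 2) * (totalWeight K + S) := by
    have : 0 ≤ log (s.card : ℝ) * S := by positivity
    linarith
  have hz0 := zero_le_logHeight₁ z
  have hw0' := zero_le_logHeight₁ w
  have final : ∀ u v : ℤ, |((r * u + t * v : ℤ) : ℝ)| + |((a₀ * v - b₀ * u : ℤ) : ℝ)| ≤ m →
      logHeight₁ (x ^ u * y ^ v) ≤ m * (4 * log s.card + 2) * (totalWeight K + S) := by
    intro u v huv
    rw [← mono u v]
    refine (logHeight₁_mul_le _ _).trans ?_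
    rw [logHeight₁_zpow, logHeight₁_zpow, Nat.cast_natAbs, Nat.cast_natAbs, Int.cast_abs,
      Int.cast_abs]
    set B := (4 * log s.card + 2) * (totalWeight K + S)
    have hB0 : 0 ≤ B := by positivity
    calc _ ≤ |((r * u + t * v : ℤ) : ℝ)| * B + |((a₀ * v - b₀ * u : ℤ) : ℝ)| * B := by
          gcongr <;> linarith
      _ ≤ m * B := by rw [← add_mul]; gcongr
      _ = _ := by ring
  constructor
  · simpa using final 1 0 (by simp; linarith)
  · simpa using final 0 1 (by simp; linarith)

end Directions

/-- Uniform height bound for solutions of a fixed shape which satisfy a multiplicative relation. -/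
lemma exists_logHeight₁_le {ι : Type} (s : Finset ι) (hs : s.Nonempty) (a b : ι → ℤ)
    (hab : ∀ i ∈ s, ∀ j ∈ s, a i = a j → b i = b j → i = j) :
    ∃ C : ℝ, 0 ≤ C ∧ ∃ T : Finset (ℤ × ℤ), (∀ d ∈ T, IsCoprime d.1 d.2) ∧
      ∀ (K : Type) [Field K] [AdmissibleAbsValues K] (c : ι → K)
      (x y : K) (p q : ℤ) (n : ℕ), (∀ i ∈ s, c i ≠ 0) → x ≠ 0 → y ≠ 0 → ¬ (p = 0 ∧ q = 0) → 0 < n →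
      ∑ i ∈ s, c i * x ^ a i * y ^ b i = 0 → (x ^ p * y ^ q) ^ n = 1 →
      (∃ d ∈ T, ∀ k, ∑ i ∈ s with d.1 * b i - d.2 * a i = k, c i * x ^ a i * y ^ b i = 0) ∨
      (logHeight₁ x ≤ C * (totalWeight K + ∑ i ∈ s, logHeight₁ (c i)) ∧
        logHeight₁ y ≤ C * (totalWeight K + ∑ i ∈ s, logHeight₁ (c i))) := by
  classical
  have hdir : ∀ e ∈ s.offDiag, ∃ d : ℤ × ℤ, IsCoprime d.1 d.2 ∧
      ∃ g : ℤ, g ≠ 0 ∧ a e.1 - a e.2 = g * d.1 ∧ b e.1 - b e.2 = g * d.2 := by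
    intro e he
    obtain ⟨he1, he2, hne⟩ := Finset.mem_offDiag.mp he
    have hpos : 0 < (a e.1 - a e.2).gcd (b e.1 - b e.2) := by
      rw [Int.gcd_pos_iff]
      by_contra! h
      exact hne (hab _ he1 _ he2 (sub_eq_zero.mp h.1) (sub_eq_zero.mp h.2))
    obtain ⟨m, n, hmn, h1, h2⟩ := Int.exists_gcd_one hpos
    exact ⟨(m, n), Int.isCoprime_iff_gcd_eq_one.mpr hmn, ((a e.1 - a e.2).gcd (b e.1 - b e.2) : ℤ),
      by exact_mod_cast hpos.ne',
      by rw [mul_comm]; exact h1, by rw [mul_comm]; exact h2⟩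
  choose! d hd g hg hga hgb using hdir
  have hnear := fun e (he : e ∈ s.offDiag) ↦ exists_logHeight₁_le_near_direction s a b (hd e he)
  choose! ε hε C hC hmain using hnear
  have hinv : ∀ e ∈ s.offDiag, 0 ≤ (ε e)⁻¹ := fun e he ↦ (inv_pos.mpr (hε e he)).le
  have hinv0 := Finset.sum_nonneg hinv
  have hC0 := Finset.sum_nonneg hC
  set δ : ℝ := (1 + ∑ e ∈ s.offDiag, (ε e)⁻¹)⁻¹ with hδ
  have hδ0 : 0 < δ := by positivity
  have hδε : ∀ e ∈ s.offDiag, δ ≤ ε e := fun e he ↦ by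
    rw [hδ]
    apply inv_le_of_inv_le₀ (hε e he)
    have := Finset.single_le_sum hinv he
    linarith
  have hlog : 0 ≤ log (s.card : ℝ) := log_natCast_nonneg _
  refine ⟨∑ e ∈ s.offDiag, C e + δ⁻¹ * (log s.card + 4), by positivity, s.offDiag.image d, ?_, ?_⟩
  · intro d' hd'
    obtain ⟨e, he, rfl⟩ := Finset.mem_image.mp hd'
    exact hd e he
  intro K _ _ c x y p q n hc hx hy hpq0 hn hsum hpq
  have hS : 0 ≤ ∑ i ∈ s, logHeight₁ (c i) := Finset.sum_nonneg fun _ _ ↦ zero_le_logHeight₁ _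
  have hT : (0 : ℝ) ≤ totalWeight K := Nat.cast_nonneg _
  by_cases hcase : ∃ e ∈ s.offDiag, |(((d e).1 * q - (d e).2 * p : ℤ) : ℝ)| ≤
      ε e * max |(p : ℝ)| |(q : ℝ)|
  · obtain ⟨e, he, hle⟩ := hcase
    rcases hmain e he K c x y p q n hx hy hpq0 hn hsum hpq hle with h | h
    · exact Or.inl ⟨d e, Finset.mem_image_of_mem d he, h⟩
    · have hCe : C e ≤ ∑ e ∈ s.offDiag, C e + δ⁻¹ * (log s.card + 4) := by
        have h1 := Finset.single_le_sum hC he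
        have h2 : 0 ≤ δ⁻¹ * (log (s.card : ℝ) + 4) := by positivity
        linarith
      have hmul := mul_le_mul_of_nonneg_right hCe (add_nonneg hT hS)
      exact Or.inr ⟨h.1.trans hmul, h.2.trans hmul⟩
  · push Not at hcase
    right
    have hR : 0 < max |(p : ℝ)| |(q : ℝ)| := by
      by_contra! h
      have hp := abs_nonpos_iff.mp ((le_max_left _ _).trans h)
      have hq := abs_nonpos_iff.mp ((le_max_right _ _).trans h)
      exact hpq0 ⟨by exact_mod_cast hp, by exact_mod_cast hq⟩
    have hfar := logHeight₁_le_of_forall_le hs hc hx hy hsum hn hpq hδ0 hR (le_max_left _ _)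
      (le_max_right _ _) fun i hi j hj hij ↦ by
        have he : (i, j) ∈ s.offDiag := Finset.mem_offDiag.mpr ⟨hi, hj, hij⟩
        have h1 := (hcase (i, j) he).le
        have h2 : (a i - a j) * q - (b i - b j) * p =
            g (i, j) * ((d (i, j)).1 * q - (d (i, j)).2 * p) := by
          rw [hga _ he, hgb _ he]; ring
        rw [h2, Int.cast_abs, Int.cast_mul, abs_mul]
        have h3 : (1 : ℝ) ≤ |(g (i, j) : ℝ)| := by
          exact_mod_cast Int.one_le_abs (hg _ he)
        have h4 := mul_le_mul_of_nonneg_right (hδε _ he) hR.le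
        exact (h4.trans h1).trans (le_mul_of_one_le_left (abs_nonneg _) h3)
    have hmul : δ⁻¹ * (log s.card * totalWeight K + 4 * ∑ i ∈ s, logHeight₁ (c i)) ≤
        (∑ e ∈ s.offDiag, C e + δ⁻¹ * (log s.card + 4)) *
          (totalWeight K + ∑ i ∈ s, logHeight₁ (c i)) := by
      have h1 : 0 ≤ (∑ e ∈ s.offDiag, C e) * (totalWeight K + ∑ i ∈ s, logHeight₁ (c i)) := by
        positivity
      have h2 : 0 ≤ δ⁻¹ * (log s.card * ∑ i ∈ s, logHeight₁ (c i)) := by positivity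
      have h3 : 0 ≤ δ⁻¹ * (4 * totalWeight K : ℝ) := by positivity
      nlinarith
    exact ⟨hfar.1.trans hmul, hfar.2.trans hmul⟩

section NumberField

variable {K : Type*} [Field K] [NumberField K]

lemma archAbsVal_intCast {v : AbsoluteValue K ℝ} (hv : v ∈ archAbsVal (K := K)) (n : ℤ) :
    v n = |(n : ℝ)| := by
  obtain ⟨φ, rfl⟩ := NumberField.mem_multisetInfinitePlace.mp hv
  simp

lemma logHeight₁_intCast_le (n : ℤ) :
    logHeight₁ (n : K) ≤ log⁺ |(n : ℝ)| * totalWeight K := by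
  have := (hasPlaceSum_posLog (n : K)).le_add hasPlaceSum_zero (C := log⁺ |(n : ℝ)|)
    (fun v hv ↦ by rw [archAbsVal_intCast hv, zero_add]) fun v hv ↦ by
      refine ((posLog_eq_zero_iff _).mpr ?_).le
      rw [abs_of_nonneg (v.nonneg _)]
      exact IsNonarchimedean.apply_intCast_le_one (isNonarchimedean v hv)
  simpa using this

lemma log_max_mul_totalWeight_le {p q : ℤ} (hpq : IsCoprime p q) (hq : q ≠ 0) :
    log (max |(p : ℝ)| |(q : ℝ)|) * totalWeight K ≤ logHeight₁ ((p : K) / q) := by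
  have hqK : (q : K) ≠ 0 := by exact_mod_cast hq
  have hF := ((hasPlaceSum_posLog ((p : K) / q)).add (hasPlaceSum_log hqK)).const_mul (-1)
  have := hF.le_add hasPlaceSum_zero (C := -log (max |(p : ℝ)| |(q : ℝ)|)) (fun v hv ↦ ?_)
    fun v hv ↦ ?_
  · linarith
  · have hq0 : 0 < |(q : ℝ)| := by simpa using hq
    have hmax : max |(p : ℝ)| |(q : ℝ)| = max 1 (|(p : ℝ)| / |(q : ℝ)|) * |(q : ℝ)| := by
      rw [max_mul_of_nonneg _ _ hq0.le, div_mul_cancel₀ _ hq0.ne', one_mul, max_comm]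
    rw [map_div₀, archAbsVal_intCast hv, archAbsVal_intCast hv, hmax,
      posLog_eq_log_max_one (by positivity), log_mul (by positivity) hq0.ne']
    linarith
  · have hna := isNonarchimedean v hv
    have hp1 : v p ≤ 1 := IsNonarchimedean.apply_intCast_le_one hna
    have hq1 : v q ≤ 1 := IsNonarchimedean.apply_intCast_le_one hna
    have hq0 := v.pos hqK
    suffices h : 0 ≤ log⁺ (v ((p : K) / q)) + log (v q) by linarith
    rcases hq1.eq_or_lt with h | h
    · rw [h, log_one, add_zero]
      exact posLog_nonneg
    · have hp : v p = 1 := by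
        by_contra hne
        obtain ⟨m, n, hmn⟩ := hpq
        have h1 : v ((m : K) * p + n * q) ≤ max (v (m * p)) (v (n * q)) := hna _ _
        have h2 : (m : K) * p + n * q = 1 := by exact_mod_cast hmn
        have hm : v m ≤ 1 := IsNonarchimedean.apply_intCast_le_one hna
        have hn : v n ≤ 1 := IsNonarchimedean.apply_intCast_le_one hna
        rw [h2, map_one, map_mul, map_mul] at h1
        have h3 : v m * v p < 1 :=
          (mul_le_of_le_one_left (v.nonneg _) hm).trans_lt (lt_of_le_of_ne hp1 hne)
        have h4 : v n * v q < 1 := (mul_le_of_le_one_left (v.nonneg _) hn).trans_lt h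
        exact absurd h1 (not_le.mpr (max_lt h3 h4))
      rw [map_div₀, hp, one_div]
      have h1 : log ((v q)⁻¹) ≤ log⁺ ((v q)⁻¹) := le_max_right _ _
      rw [log_inv] at h1
      linarith

end NumberField

lemma exists_logHeight₁_le_of_aeval_eq_zero {P : Polynomial ℤ} (hP : P ≠ 0) :
    ∃ C : ℝ, ∀ (K : Type) [Field K] [NumberField K] (z : K), Polynomial.aeval z P = 0 →
      logHeight₁ z ≤ C * totalWeight K := by
  refine ⟨2 * log P.support.card + ∑ i ∈ P.support, log⁺ |(P.coeff i : ℝ)|, fun K _ _ z hz ↦ ?_⟩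
  have hlog : 0 ≤ log (P.support.card : ℝ) := log_natCast_nonneg _
  rcases eq_or_ne z 0 with rfl | hz0
  · rw [logHeight₁_zero]
    have := Finset.sum_nonneg fun i (_ : i ∈ P.support) ↦ posLog_nonneg (x := |(P.coeff i : ℝ)|)
    positivity
  have h := logHeight₁_root_le (s := P.support) (a := fun _ ↦ 0) (b := fun i ↦ (i : ℤ))
    (c := fun i ↦ (P.coeff i : K)) (x := 1) hz0 (D := 0) (by simp)
    (by simpa [Polynomial.aeval_def, Polynomial.eval₂_eq_sum, Polynomial.sum_def] using hz)
    ⟨(P.natDegree : ℤ), by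
      have : P.support.filter (fun i : ℕ ↦ (i : ℤ) = P.natDegree) = {P.natDegree} := by
        ext i
        simp only [Finset.mem_filter, Finset.mem_singleton, Nat.cast_inj]
        refine ⟨fun h ↦ h.2, ?_⟩
        rintro rfl
        exact ⟨Polynomial.natDegree_mem_support_of_nonzero hP, rfl⟩
      rw [this]
      simpa using hP⟩
  have h1 : ∑ i ∈ P.support, logHeight₁ (P.coeff i : K) ≤
      (∑ i ∈ P.support, log⁺ |(P.coeff i : ℝ)|) * totalWeight K := by
    rw [Finset.sum_mul]
    exact Finset.sum_le_sum fun i _ ↦ logHeight₁_intCast_le _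
  rw [Nat.cast_zero, mul_zero, zero_mul, add_zero] at h
  linarith

lemma logHeight₁_sum_intCast_mul_le {K : Type*} [Field K] [NumberField K] {ι : Type*} (s : Finset ι)
    (e a b : ι → ℤ) (c : ι → K) (x y : K) :
    logHeight₁ (∑ i ∈ s, e i * (c i * x ^ a i * y ^ b i)) ≤
      (log s.card + ∑ i ∈ s, log⁺ |(e i : ℝ)|) * totalWeight K + ∑ i ∈ s, logHeight₁ (c i) +
      (∑ i ∈ s, ((a i).natAbs : ℝ)) * logHeight₁ x +
      (∑ i ∈ s, ((b i).natAbs : ℝ)) * logHeight₁ y := by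
  have h1 := logHeight₁_sum_le s (fun i ↦ (e i : K) * (c i * x ^ a i * y ^ b i))
  have h2 : ∑ i ∈ s, logHeight₁ ((e i : K) * (c i * x ^ a i * y ^ b i)) ≤
      ∑ i ∈ s, (log⁺ |(e i : ℝ)| * totalWeight K + logHeight₁ (c i) +
        (a i).natAbs * logHeight₁ x + (b i).natAbs * logHeight₁ y) := by
    refine Finset.sum_le_sum fun i _ ↦ ?_
    have h3 := logHeight₁_mul_le (e i : K) (c i * x ^ a i * y ^ b i)
    have h4 := logHeight₁_mul_le (c i * x ^ a i) (y ^ b i)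
    have h5 := logHeight₁_mul_le (c i) (x ^ a i)
    rw [logHeight₁_zpow] at h4 h5
    have h6 := logHeight₁_intCast_le (K := K) (e i)
    linarith
  simp only [Finset.sum_add_distrib, ← Finset.sum_mul] at h2
  linarith

/-- The exponents of a torsion variety tangent to a fixed curve are bounded in terms of the
heights of the coefficients. -/
lemma exists_log_max_le {ι : Type} (s : Finset ι) (hs : s.Nonempty) (a b : ι → ℤ)
    (hab : ∀ i ∈ s, ∀ j ∈ s, a i = a j → b i = b j → i = j) :
    ∃ C : ℝ, 0 ≤ C ∧ ∃ B : ℝ, ∀ (K : Type) [Field K] [NumberField K] (c : ι → K)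
      (x y : K) (p q : ℤ) (n : ℕ), (∀ i ∈ s, c i ≠ 0) → x ≠ 0 → y ≠ 0 → IsCoprime p q → 0 < n →
      ∑ i ∈ s, c i * x ^ a i * y ^ b i = 0 → (x ^ p * y ^ q) ^ n = 1 →
      p * ∑ i ∈ s, b i * (c i * x ^ a i * y ^ b i) =
        q * ∑ i ∈ s, a i * (c i * x ^ a i * y ^ b i) →
      ¬ (∑ i ∈ s, a i * (c i * x ^ a i * y ^ b i) = 0 ∧
        ∑ i ∈ s, b i * (c i * x ^ a i * y ^ b i) = 0) →
      max |(p : ℝ)| |(q : ℝ)| ≤ B ∨ log (max |(p : ℝ)| |(q : ℝ)|) * totalWeight K ≤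
        C * (totalWeight K + ∑ i ∈ s, logHeight₁ (c i)) := by
  obtain ⟨C, hC, T, hT, hmain⟩ := exists_logHeight₁_le s hs a b hab
  have hlog : 0 ≤ log (s.card : ℝ) := log_natCast_nonneg _
  have hA : 0 ≤ ∑ i ∈ s, log⁺ |(a i : ℝ)| := Finset.sum_nonneg fun _ _ ↦ posLog_nonneg
  have hB : 0 ≤ ∑ i ∈ s, log⁺ |(b i : ℝ)| := Finset.sum_nonneg fun _ _ ↦ posLog_nonneg
  have hA' : 0 ≤ ∑ i ∈ s, ((a i).natAbs : ℝ) := Finset.sum_nonneg fun _ _ ↦ Nat.cast_nonneg _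
  have hB' : 0 ≤ ∑ i ∈ s, ((b i).natAbs : ℝ) := Finset.sum_nonneg fun _ _ ↦ Nat.cast_nonneg _
  refine ⟨2 * log s.card + ∑ i ∈ s, log⁺ |(a i : ℝ)| + ∑ i ∈ s, log⁺ |(b i : ℝ)| + 2 +
    2 * (∑ i ∈ s, ((a i).natAbs : ℝ)) * C + 2 * (∑ i ∈ s, ((b i).natAbs : ℝ)) * C, by positivity,
    1 + ∑ d ∈ T, (|(d.1 : ℝ)| + |(d.2 : ℝ)|), ?_⟩
  intro K _ _ c x y p q n hc hx hy hcop hn hsum hpq htan hne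
  have hTnn : ∀ d ∈ T, 0 ≤ |(d.1 : ℝ)| + |(d.2 : ℝ)| := fun d _ ↦ by positivity
  have hpq0 : ¬ (p = 0 ∧ q = 0) := by
    rintro ⟨rfl, rfl⟩
    exact not_isCoprime_zero_zero hcop
  set F := ∑ i ∈ s, a i * (c i * x ^ a i * y ^ b i) with hF
  set G := ∑ i ∈ s, b i * (c i * x ^ a i * y ^ b i) with hG
  by_cases hq0 : q = 0
  · left
    subst hq0
    rw [isCoprime_zero_right, Int.isUnit_iff] at hcop
    have := Finset.sum_nonneg hTnn
    rcases hcop with rfl | rfl <;> simpa using this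
  rcases hmain K c x y p q n hc hx hy hpq0 hn hsum hpq with ⟨d, hd, hdeg⟩ | ⟨hhx, hhy⟩
  · left
    have hd' : (d.1 : K) * G = d.2 * F := by
      have h1 : (d.1 : K) * G - d.2 * F =
          ∑ i ∈ s, ((d.1 * b i - d.2 * a i : ℤ) : K) * (c i * x ^ a i * y ^ b i) := by
        rw [hF, hG, Finset.mul_sum, Finset.mul_sum, ← Finset.sum_sub_distrib]
        exact Finset.sum_congr rfl fun i _ ↦ by push_cast; ring
      rw [← sub_eq_zero, h1, ← Finset.sum_fiberwise_of_maps_to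
        (t := s.image fun i ↦ d.1 * b i - d.2 * a i)
        (g := fun i ↦ d.1 * b i - d.2 * a i) (fun i hi ↦ Finset.mem_image_of_mem _ hi)]
      refine Finset.sum_eq_zero fun k _ ↦ ?_
      rw [← mul_zero (k : K), ← hdeg k, Finset.mul_sum]
      exact Finset.sum_congr rfl fun i hi ↦ by rw [(Finset.mem_filter.mp hi).2]
    have hdet : p * d.2 = q * d.1 := by
      have hF1 : ((p * d.2 - q * d.1 : ℤ) : K) * F = 0 := by
        push_cast; linear_combination (-p : K) * hd' + (d.1 : K) * htan
      have hG1 : ((p * d.2 - q * d.1 : ℤ) : K) * G = 0 := by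
        push_cast; linear_combination (d.2 : K) * htan - (q : K) * hd'
      by_contra h
      have h0 : ((p * d.2 - q * d.1 : ℤ) : K) ≠ 0 := by
        exact_mod_cast sub_ne_zero.mpr h
      exact hne ⟨(mul_eq_zero.mp hF1).resolve_left h0, (mul_eq_zero.mp hG1).resolve_left h0⟩
    have hcopd := hT d hd
    have hpd : p ∣ d.1 := hcop.dvd_of_dvd_mul_left ⟨d.2, hdet.symm⟩
    have hqd : q ∣ d.2 := hcop.symm.dvd_of_dvd_mul_left ⟨d.1, hdet⟩
    have hdp : d.1 ∣ p := hcopd.dvd_of_dvd_mul_right ⟨q, by linarith⟩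
    have hdq : d.2 ∣ q := hcopd.symm.dvd_of_dvd_mul_right ⟨p, by linarith⟩
    have h1 : |p| = |d.1| := by
      rw [Int.abs_eq_natAbs, Int.abs_eq_natAbs, Int.natAbs_eq_of_dvd_dvd hpd hdp]
    have h2 : |q| = |d.2| := by
      rw [Int.abs_eq_natAbs, Int.abs_eq_natAbs, Int.natAbs_eq_of_dvd_dvd hqd hdq]
    have h1' : |(p : ℝ)| = |(d.1 : ℝ)| := by exact_mod_cast h1
    have h2' : |(q : ℝ)| = |(d.2 : ℝ)| := by exact_mod_cast h2
    have h3 := Finset.single_le_sum hTnn hd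
    have h4 := abs_nonneg (d.1 : ℝ)
    have h5 := abs_nonneg (d.2 : ℝ)
    rw [h1', h2', max_le_iff]
    constructor <;> linarith
  · right
    have hqK : (q : K) ≠ 0 := by exact_mod_cast hq0
    have hG0 : G ≠ 0 := by
      intro h
      rw [h, mul_zero, eq_comm, mul_eq_zero, or_iff_right hqK] at htan
      exact hne ⟨htan, h⟩
    have hquot : (p : K) / q = F * G⁻¹ := by
      rw [div_eq_iff hqK]
      field_simp
      linear_combination htan
    have h1 := log_max_mul_totalWeight_le (K := K) hcop hq0
    have h2 := logHeight₁_mul_le F G⁻¹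
    rw [logHeight₁_inv] at h2
    rw [hquot] at h1
    have h3 := logHeight₁_sum_intCast_mul_le s a a b c x y
    have h4 := logHeight₁_sum_intCast_mul_le s b a b c x y
    have hTW : (0 : ℝ) ≤ totalWeight K := Nat.cast_nonneg _
    have hS : 0 ≤ ∑ i ∈ s, logHeight₁ (c i) := Finset.sum_nonneg fun _ _ ↦ zero_le_logHeight₁ _
    have h5 := mul_le_mul_of_nonneg_left hhx hA'
    have h6 := mul_le_mul_of_nonneg_left hhy hB'
    have h7 := mul_nonneg (add_nonneg (add_nonneg (mul_nonneg zero_le_two hlog) hA) hB) hS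
    linarith

lemma exists_max_le {E : Type} [Field E] [CharZero E] [Algebra.IsAlgebraic ℚ E] {ι : Type}
    (s : Finset ι) (hs : s.Nonempty) (a b : ι → ℤ)
    (hab : ∀ i ∈ s, ∀ j ∈ s, a i = a j → b i = b j → i = j) (c : ι → E)
    (hc : ∀ i ∈ s, c i ≠ 0) :
    ∃ B : ℝ, ∀ (x y : E) (p q : ℤ) (n : ℕ), x ≠ 0 → y ≠ 0 → IsCoprime p q → 0 < n →
      ∑ i ∈ s, c i * x ^ a i * y ^ b i = 0 → (x ^ p * y ^ q) ^ n = 1 →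
      p * ∑ i ∈ s, b i * (c i * x ^ a i * y ^ b i) =
        q * ∑ i ∈ s, a i * (c i * x ^ a i * y ^ b i) →
      ¬ (∑ i ∈ s, a i * (c i * x ^ a i * y ^ b i) = 0 ∧
        ∑ i ∈ s, b i * (c i * x ^ a i * y ^ b i) = 0) →
      max |(p : ℝ)| |(q : ℝ)| ≤ B := by
  classical
  obtain ⟨C, hC, B, hmain⟩ := exists_log_max_le s hs a b hab
  have hpoly : ∀ i, ∃ P : Polynomial ℤ, P ≠ 0 ∧ Polynomial.aeval (c i) P = 0 := fun i ↦
    (IsFractionRing.isAlgebraic_iff ℤ ℚ E).mpr (Algebra.IsAlgebraic.isAlgebraic (c i))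
  choose P hP hPc using hpoly
  choose D hD using fun i ↦ exists_logHeight₁_le_of_aeval_eq_zero (hP i)
  refine ⟨max B (exp (C * (1 + ∑ i ∈ s, D i))), ?_⟩
  intro x y p q n hx hy hcop hn hsum hpq htan hne
  let L := IntermediateField.adjoin ℚ ((insert x (insert y (s.image c)) : Finset E) : Set E)
  have hfin : FiniteDimensional ℚ L := IntermediateField.finiteDimensional_adjoin fun z _ ↦
    Algebra.IsIntegral.isIntegral z
  have : NumberField L := { to_charZero := inferInstance, to_finiteDimensional := hfin }
  have hmem : ∀ z ∈ insert x (insert y (s.image c)), z ∈ L := fun z hz ↦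
    IntermediateField.subset_adjoin ℚ _ (Finset.mem_coe.mpr hz)
  have hcL : ∀ i, ∃ z : L, i ∈ s → (z : E) = c i := fun i ↦ by
    by_cases hi : i ∈ s
    · exact ⟨⟨c i, hmem _ (Finset.mem_insert_of_mem (Finset.mem_insert_of_mem
        (Finset.mem_image_of_mem c hi)))⟩, fun _ ↦ rfl⟩
    · exact ⟨0, fun h ↦ absurd h hi⟩
  choose c' hc' using hcL
  let x' : L := ⟨x, hmem x (by simp)⟩
  let y' : L := ⟨y, hmem y (by simp)⟩
  have hinj : Function.Injective (algebraMap L E) := (algebraMap L E).injective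
  have hu : ∀ i ∈ s, algebraMap L E (c' i * x' ^ a i * y' ^ b i) = c i * x ^ a i * y ^ b i := by
    intro i hi
    rw [map_mul, map_mul, map_zpow₀, map_zpow₀, ← hc' i hi]
    rfl
  have hweight : ∀ e : ι → ℤ, algebraMap L E (∑ i ∈ s, e i * (c' i * x' ^ a i * y' ^ b i)) =
      ∑ i ∈ s, e i * (c i * x ^ a i * y ^ b i) := by
    intro e
    rw [map_sum]
    exact Finset.sum_congr rfl fun i hi ↦ by rw [map_mul, hu i hi, map_intCast]
  have h := hmain L c' x' y' p q n (fun i hi h0 ↦ hc i hi (by rw [← hc' i hi, h0]; rfl))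
    (fun h0 ↦ hx (congrArg (algebraMap L E) h0)) (fun h0 ↦ hy (congrArg (algebraMap L E) h0))
    hcop hn (hinj (by rw [map_sum, map_zero, ← hsum]; exact Finset.sum_congr rfl hu))
    (hinj (by rw [map_pow, map_mul, map_zpow₀, map_zpow₀, map_one]; exact hpq))
    (hinj (by rw [map_mul, map_mul, hweight, hweight, map_intCast, map_intCast]; exact htan))
    (fun h0 ↦ hne ⟨by rw [← hweight, h0.1, map_zero], by rw [← hweight, h0.2, map_zero]⟩)
  rcases h with h | h
  · exact h.trans (le_max_left _ _)
  · refine le_trans ?_ (le_max_right _ _)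
    have hpos : 0 < max |(p : ℝ)| |(q : ℝ)| := by
      by_contra! h0
      have hp := abs_nonpos_iff.mp ((le_max_left _ _).trans h0)
      have hq := abs_nonpos_iff.mp ((le_max_right _ _).trans h0)
      rw [Int.cast_eq_zero] at hp hq
      exact not_isCoprime_zero_zero (hp ▸ hq ▸ hcop)
    rw [← log_le_iff_le_exp hpos]
    have hTW : (0 : ℝ) < totalWeight L := by exact_mod_cast NumberField.totalWeight_pos L
    have hsumD : ∑ i ∈ s, logHeight₁ (c' i) ≤ (∑ i ∈ s, D i) * totalWeight L := by
      rw [Finset.sum_mul]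
      refine Finset.sum_le_sum fun i hi ↦ hD i L (c' i) (hinj ?_)
      rw [map_zero, ← Polynomial.aeval_algebraMap_apply, ← hPc i, ← hc' i hi]
      rfl
    refine le_of_mul_le_mul_right (h.trans ?_) hTW
    have := mul_le_mul_of_nonneg_left hsumD hC
    linarith

lemma finite_primeSpectrum_quotient {R : Type*} [CommRing R] [IsDomain R] [IsNoetherianRing R]
    (hdim : ringKrullDim R ≤ 2) {f g : R} (hf : Prime f) (hfg : ¬ f ∣ g) :
    Finite (PrimeSpectrum
      ((R ⧸ Ideal.span {f}) ⧸ Ideal.span {Ideal.Quotient.mk (Ideal.span {f}) g})) := by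
  have hprime : (Ideal.span {f}).IsPrime := (Ideal.span_singleton_prime hf.ne_zero).mpr hf
  have hg : Ideal.Quotient.mk (Ideal.span {f}) g ≠ 0 := by
    rwa [Ne, Ideal.Quotient.eq_zero_iff_mem, Ideal.mem_span_singleton]
  have h1 := (ringKrullDim_quotient_succ_le_of_nonZeroDivisor
    (mem_nonZeroDivisors_of_ne_zero hf.ne_zero)).trans hdim
  have h2 := ringKrullDim_quotient_succ_le_of_nonZeroDivisor (mem_nonZeroDivisors_of_ne_zero hg)
  have h3 := ((add_le_add_left h2 1).trans h1).trans_eq (by norm_num : (2 : WithBot ℕ∞) = 0 + 1 + 1)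
  rw [ENat.WithBot.add_le_add_one_right_iff, ENat.WithBot.add_le_add_one_right_iff] at h3
  have hart : IsArtinianRing
      ((R ⧸ Ideal.span {f}) ⧸ Ideal.span {Ideal.Quotient.mk (Ideal.span {f}) g}) :=
    isArtinianRing_iff_isNoetherianRing_krullDimLE_zero.mpr
      ⟨inferInstance, Ring.krullDimLE_iff.mpr h3⟩
  infer_instance

/-- Two plane curves, the first of them irreducible and not contained in the second, meet in
finitely many points. -/
lemma finite_setOf_eval_eq_zero {k : Type*} [Field k] {f g : MvPolynomial (Fin 2) k}
    (hf : Irreducible f) (hfg : ¬ f ∣ g) :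
    {P : Fin 2 → k | MvPolynomial.eval P f = 0 ∧ MvPolynomial.eval P g = 0}.Finite := by
  have hdim : ringKrullDim (MvPolynomial (Fin 2) k) ≤ 2 := by
    rw [MvPolynomial.ringKrullDim_of_isNoetherianRing]
    simp
  have hfin := finite_primeSpectrum_quotient hdim hf.prime hfg
  let φ : {P : Fin 2 → k | MvPolynomial.eval P f = 0 ∧ MvPolynomial.eval P g = 0} →
      (MvPolynomial (Fin 2) k ⧸ Ideal.span {f}) ⧸
        Ideal.span {Ideal.Quotient.mk (Ideal.span {f}) g} →+* k :=
    fun P ↦ Ideal.Quotient.lift _ (Ideal.Quotient.lift (Ideal.span {f}) (MvPolynomial.eval P.1)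
      fun z hz ↦ by
        obtain ⟨w, rfl⟩ := Ideal.mem_span_singleton.mp hz
        rw [map_mul, P.2.1, zero_mul]) fun z hz ↦ by
        obtain ⟨w, rfl⟩ := Ideal.mem_span_singleton.mp hz
        exact (map_mul _ _ _).trans (mul_eq_zero_of_left P.2.2 _)
  have hφ : ∀ P z, φ P (Ideal.Quotient.mk _ (Ideal.Quotient.mk _ z)) = MvPolynomial.eval P.1 z :=
    fun P z ↦ rfl
  rw [← Set.finite_coe_iff]
  refine Finite.of_injective (fun P ↦ (⟨RingHom.ker (φ P), RingHom.ker_isPrime _⟩ :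
    PrimeSpectrum ((MvPolynomial (Fin 2) k ⧸ Ideal.span {f}) ⧸
      Ideal.span {Ideal.Quotient.mk (Ideal.span {f}) g}))) fun P Q hPQ ↦
      Subtype.ext (funext fun i ↦ ?_)
  have hker : RingHom.ker (φ P) = RingHom.ker (φ Q) := congrArg PrimeSpectrum.asIdeal hPQ
  have hmem : Ideal.Quotient.mk _
      (Ideal.Quotient.mk _ (MvPolynomial.X i - MvPolynomial.C (P.1 i))) ∈ RingHom.ker (φ P) := by
    rw [RingHom.mem_ker, hφ]; simp
  rw [hker, RingHom.mem_ker, hφ] at hmem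
  rw [map_sub, MvPolynomial.eval_X, MvPolynomial.eval_C, sub_eq_zero] at hmem
  exact hmem.symm

section Curve

variable {E : Type} [Field E]

lemma coeff_X_mul_pderiv (f : MvPolynomial (Fin 2) E) (i : Fin 2) (m : Fin 2 →₀ ℕ) :
    (MvPolynomial.X i * MvPolynomial.pderiv i f).coeff m = m i * f.coeff m := by
  classical
  induction f using MvPolynomial.induction_on' with
  | monomial n c =>
    rw [MvPolynomial.X_mul_pderiv_monomial, MvPolynomial.coeff_smul, MvPolynomial.coeff_monomial,
      nsmul_eq_mul]
    split_ifs with h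
    · rw [h]
    · simp
  | add f g hf hg => rw [map_add, mul_add, MvPolynomial.coeff_add, hf, hg, MvPolynomial.coeff_add,
      mul_add]

lemma eval_eq_sum_of_support_subset {f g : MvPolynomial (Fin 2) E} (h : g.support ⊆ f.support)
    (x y : E) : MvPolynomial.eval ![x, y] g =
      ∑ m ∈ f.support, g.coeff m * x ^ (m 0 : ℤ) * y ^ (m 1 : ℤ) := by
  rw [MvPolynomial.eval_eq']
  simp only [Fin.prod_univ_two, Matrix.cons_val_zero, Matrix.cons_val_one, zpow_natCast,
    ← mul_assoc]
  exact Finset.sum_subset h fun m _ hm ↦ by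
    rw [MvPolynomial.notMem_support_iff.mp hm, zero_mul, zero_mul]

lemma support_X_mul_pderiv_subset (f : MvPolynomial (Fin 2) E) (i : Fin 2) :
    (MvPolynomial.X i * MvPolynomial.pderiv i f).support ⊆ f.support := fun m hm ↦ by
  rw [MvPolynomial.mem_support_iff, coeff_X_mul_pderiv] at hm
  exact MvPolynomial.mem_support_iff.mpr (right_ne_zero_of_mul hm)

lemma eval_X_mul_pderiv (f : MvPolynomial (Fin 2) E) (i : Fin 2) (x y : E) :
    MvPolynomial.eval ![x, y] (MvPolynomial.X i * MvPolynomial.pderiv i f) =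
      ∑ m ∈ f.support, (m i : ℤ) * (f.coeff m * x ^ (m 0 : ℤ) * y ^ (m 1 : ℤ)) := by
  rw [eval_eq_sum_of_support_subset (support_X_mul_pderiv_subset f i)]
  exact Finset.sum_congr rfl fun m _ ↦ by
    rw [coeff_X_mul_pderiv, Int.cast_natCast]; ring

/-- The polynomial whose vanishing on the curve `f = 0` expresses tangency to a translate of
`{x ^ p * y ^ q = 1}`. -/
noncomputable def tangency (f : MvPolynomial (Fin 2) E) (p q : ℤ) : MvPolynomial (Fin 2) E :=
  MvPolynomial.C (p : E) * (MvPolynomial.X 1 * MvPolynomial.pderiv 1 f) -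
    MvPolynomial.C (q : E) * (MvPolynomial.X 0 * MvPolynomial.pderiv 0 f)

lemma coeff_tangency (f : MvPolynomial (Fin 2) E) (p q : ℤ) (m : Fin 2 →₀ ℕ) :
    (tangency f p q).coeff m = ((p * m 1 - q * m 0 : ℤ) : E) * f.coeff m := by
  rw [tangency, MvPolynomial.coeff_sub, MvPolynomial.coeff_C_mul, MvPolynomial.coeff_C_mul,
    coeff_X_mul_pderiv, coeff_X_mul_pderiv]
  push_cast
  ring

/-- If `f` divides its tangency polynomial then `f` is homogeneous for the corresponding weight. -/
lemma exists_weight_of_dvd_tangency [CharZero E] {f : MvPolynomial (Fin 2) E} (hf : f ≠ 0) {p q : ℤ}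
    (h : f ∣ tangency f p q) : ∃ k : ℤ, ∀ m ∈ f.support, p * m 1 - q * m 0 = k := by
  obtain ⟨r, hr⟩ : ∃ r : E, tangency f p q = MvPolynomial.C r * f := by
    obtain ⟨g, hg⟩ := h
    rcases eq_or_ne g 0 with rfl | hg0
    · exact ⟨0, by rw [hg, map_zero, mul_zero, zero_mul]⟩
    have h1 : (tangency f p q).totalDegree ≤ f.totalDegree := by
      refine Finset.sup_mono fun m hm ↦ ?_
      rw [MvPolynomial.mem_support_iff, coeff_tangency] at hm
      exact MvPolynomial.mem_support_iff.mpr (right_ne_zero_of_mul hm)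
    rw [hg, MvPolynomial.totalDegree_mul_of_isDomain hf hg0] at h1
    exact ⟨g.coeff 0, by
      rw [← MvPolynomial.totalDegree_eq_zero_iff_eq_C.mp (by omega : g.totalDegree = 0), hg,
        mul_comm]⟩
  have hcoeff : ∀ m ∈ f.support, ((p * m 1 - q * m 0 : ℤ) : E) = r := fun m hm ↦ by
    have h1 := congrArg (MvPolynomial.coeff m) hr
    rw [coeff_tangency, MvPolynomial.coeff_C_mul] at h1
    exact mul_right_cancel₀ (MvPolynomial.mem_support_iff.mp hm) h1
  obtain ⟨m₀, hm₀⟩ := MvPolynomial.support_nonempty.mpr hf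
  exact ⟨p * m₀ 1 - q * m₀ 0, fun m hm ↦ by
    exact_mod_cast (hcoeff m hm).trans (hcoeff m₀ hm₀).symm⟩

lemma eval_mul_zpow_eq {f : MvPolynomial (Fin 2) E} {a b k : ℤ}
    (h : ∀ m ∈ f.support, a * m 1 - b * m 0 = k) (x y : E) {l : E} (hl : l ≠ 0) :
    MvPolynomial.eval ![x * l ^ (-b), y * l ^ a] f = l ^ k * MvPolynomial.eval ![x, y] f := by
  rw [eval_eq_sum_of_support_subset subset_rfl, eval_eq_sum_of_support_subset subset_rfl,
    Finset.mul_sum]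
  refine Finset.sum_congr rfl fun m hm ↦ ?_
  rw [← h m hm, mul_zpow, mul_zpow, ← zpow_mul, ← zpow_mul,
    show a * (m 1 : ℤ) - b * m 0 = -b * m 0 + a * m 1 by ring, zpow_add₀ hl]
  ring

/-- A weighted homogeneous irreducible curve with a point `(x, y)` on it is a translate of a
subtorus. -/
lemma eval_eq_zero_iff_of_weight [CharZero E] {f : MvPolynomial (Fin 2) E} (hf : Irreducible f)
    {a b k : ℤ} (hab : IsCoprime a b) (h : ∀ m ∈ f.support, a * m 1 - b * m 0 = k) {x y : E}
    (hx : x ≠ 0) (hy : y ≠ 0) (hxy : MvPolynomial.eval ![x, y] f = 0) {z w : E} (hz : z ≠ 0)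
    (hw : w ≠ 0) :
    MvPolynomial.eval ![z, w] f = 0 ↔ z ^ a * w ^ b = x ^ a * y ^ b := by
  obtain ⟨r, t, hrt⟩ := hab
  have hcurve : ∀ l : E, l ≠ 0 → MvPolynomial.eval ![x * l ^ (-b), y * l ^ a] f = 0 :=
    fun l hl ↦ by rw [eval_mul_zpow_eq h x y hl, hxy, mul_zero]
  constructor
  · intro hzw
    let B : MvPolynomial (Fin 2) E :=
      MvPolynomial.X 0 ^ a.toNat * MvPolynomial.X 1 ^ b.toNat - MvPolynomial.C (x ^ a * y ^ b) *
        (MvPolynomial.X 0 ^ (-a).toNat * MvPolynomial.X 1 ^ (-b).toNat)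
    have hB : ∀ z w : E, z ≠ 0 → w ≠ 0 →
        (MvPolynomial.eval ![z, w] B = 0 ↔ z ^ a * w ^ b = x ^ a * y ^ b) := by
      intro z w hz hw
      have hpow : ∀ {u : E} (_ : u ≠ 0) (n : ℤ), u ^ n * u ^ (-n).toNat = u ^ n.toNat := by
        intro u hu n
        rw [← zpow_natCast, ← zpow_natCast, ← zpow_add₀ hu]
        congr 1
        omega
      have h1 : MvPolynomial.eval ![z, w] B = (z ^ a * w ^ b - x ^ a * y ^ b) *
          (z ^ (-a).toNat * w ^ (-b).toNat) := by
        simp only [B, map_sub, map_mul, map_pow, MvPolynomial.eval_X, MvPolynomial.eval_C,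
          Matrix.cons_val_zero, Matrix.cons_val_one]
        rw [← hpow hz a, ← hpow hw b]
        ring
      rw [h1, mul_eq_zero, or_iff_left (by positivity), sub_eq_zero]
    have hdvd : f ∣ B := by
      by_contra hndvd
      have hne : ∀ l : ℕ, (l + 1 : E) ≠ 0 := fun l ↦ Nat.cast_add_one_ne_zero l
      have hinj : Function.Injective
          fun l : ℕ ↦ ![x * (l + 1 : E) ^ (-b), y * (l + 1 : E) ^ a] := fun l l' hll ↦ by
        have h0 : (l + 1 : E) ^ (-b) = (l' + 1 : E) ^ (-b) := mul_left_cancel₀ hx (congrFun hll 0)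
        have h1 : (l + 1 : E) ^ a = (l' + 1 : E) ^ a := mul_left_cancel₀ hy (congrFun hll 1)
        have hrec : ∀ l : E, l ≠ 0 → l = (l ^ a) ^ r * (l ^ (-b)) ^ (-t) := fun l hl ↦ by
          rw [← zpow_mul, ← zpow_mul, ← zpow_add₀ hl, show a * r + -b * -t = 1 by linarith,
            zpow_one]
        have h2 : (l + 1 : E) = l' + 1 := by rw [hrec _ (hne l), h0, h1, ← hrec _ (hne l')]
        exact_mod_cast add_right_cancel h2
      refine (finite_setOf_eval_eq_zero hf hndvd).not_infinite
        (Set.infinite_of_injective_forall_mem hinj fun l ↦ ⟨hcurve _ (hne l), ?_⟩)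
      have hl := hne l
      rw [hB _ _ (mul_ne_zero hx (zpow_ne_zero _ hl)) (mul_ne_zero hy (zpow_ne_zero _ hl)),
        mul_zpow, mul_zpow, ← zpow_mul, ← zpow_mul, show -b * a = -(a * b) by ring, zpow_neg]
      have := zpow_ne_zero (a * b) hl
      field_simp
    obtain ⟨g, hg⟩ := hdvd
    rw [← hB z w hz hw, hg, map_mul, hzw, zero_mul]
  · intro hzw
    set u := z / x with hu
    set v := w / y with hv
    have hu0 : u ≠ 0 := div_ne_zero hz hx
    have hv0 : v ≠ 0 := div_ne_zero hw hy
    have huv : u ^ a * v ^ b = 1 := by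
      have h1 : x ^ a * y ^ b ≠ 0 := mul_ne_zero (zpow_ne_zero _ hx) (zpow_ne_zero _ hy)
      rw [hu, hv, div_zpow, div_zpow, div_mul_div_comm, hzw, div_self h1]
    have hua : u ^ a = v ^ (-b) := by
      rw [zpow_neg]; exact eq_inv_of_mul_eq_one_left huv
    have hl : v ^ r * u ^ (-t) ≠ 0 := mul_ne_zero (zpow_ne_zero _ hv0) (zpow_ne_zero _ hu0)
    have h1 : x * (v ^ r * u ^ (-t)) ^ (-b) = z := by
      have : (v ^ r * u ^ (-t)) ^ (-b) = u := by
        rw [mul_zpow, ← zpow_mul, mul_comm r, zpow_mul, ← hua, ← zpow_mul, ← zpow_mul,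
          ← zpow_add₀ hu0, show a * r + -t * -b = 1 by linarith, zpow_one]
      rw [this, hu, mul_div_cancel₀ _ hx]
    have h2 : y * (v ^ r * u ^ (-t)) ^ a = w := by
      have : (v ^ r * u ^ (-t)) ^ a = v := by
        rw [mul_zpow, ← zpow_mul, ← zpow_mul, mul_comm (-t), zpow_mul u, hua, ← zpow_mul,
          ← zpow_add₀ hv0, show r * a + -b * -t = 1 by linarith, zpow_one]
      rw [this, hv, mul_div_cancel₀ _ hy]
    rw [← h1, ← h2]
    exact hcurve _ hl

end Curve

end PlaceSum

/-- **Theorem (finiteness of `C^{1,tor}`).**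
Let `f ∈ Qbar[X,Y]` be irreducible, defining a curve `C` in `G_m²` which is not a torsion
variety.  Then the union of all singular intersections of `C` with 1-dimensional torsion
subvarieties `ζH_{p,q}` of `G_m²` — i.e. the set of smooth points `(x,y)` of `C` satisfying
`x^p y^q = ω` for some coprime `(p,q) ≠ (0,0)` and some root of unity `ω`, with coinciding
tangent lines — is finite. -/
theorem finiteness_of_singular_intersections_with_torsion_varieties
    (f : MvPolynomial (Fin 2) Qbar) (hirr : Irreducible f)
    (hnt : ¬ IsTorsionVariety (curve f)) :
    {P : Qbar × Qbar | P.1 ≠ 0 ∧ P.2 ≠ 0 ∧ MvPolynomial.eval ![P.1, P.2] f = 0 ∧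
      ¬(MvPolynomial.eval ![P.1, P.2] (MvPolynomial.pderiv 0 f) = 0 ∧
        MvPolynomial.eval ![P.1, P.2] (MvPolynomial.pderiv 1 f) = 0) ∧
      ∃ (p q : ℤ) (ω : Qbar), IsCoprime p q ∧ ¬(p = 0 ∧ q = 0) ∧
        (∃ n : ℕ, 0 < n ∧ ω ^ n = 1) ∧ P.1 ^ p * P.2 ^ q = ω ∧
        (p : Qbar) * P.2 * MvPolynomial.eval ![P.1, P.2] (MvPolynomial.pderiv 1 f)
          = (q : Qbar) * P.1 * MvPolynomial.eval ![P.1, P.2] (MvPolynomial.pderiv 0 f)}.Finite := by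
  have hsup0 := MvPolynomial.support_nonempty.mpr hirr.ne_zero
  have hXY : ∀ (x y : Qbar) (i : Fin 2), ∑ m ∈ f.support, ((m i : ℤ) : Qbar) *
      (f.coeff m * x ^ (m 0 : ℤ) * y ^ (m 1 : ℤ)) =
      ![x, y] i * MvPolynomial.eval ![x, y] (MvPolynomial.pderiv i f) := fun x y i ↦ by
    rw [← PlaceSum.eval_X_mul_pderiv, map_mul, MvPolynomial.eval_X]
  have hsmooth : ∀ x y : Qbar, x ≠ 0 → y ≠ 0 →
      ¬(MvPolynomial.eval ![x, y] (MvPolynomial.pderiv 0 f) = 0 ∧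
        MvPolynomial.eval ![x, y] (MvPolynomial.pderiv 1 f) = 0) →
      ¬(x * MvPolynomial.eval ![x, y] (MvPolynomial.pderiv 0 f) = 0 ∧
        y * MvPolynomial.eval ![x, y] (MvPolynomial.pderiv 1 f) = 0) := fun x y hx hy h h' ↦
    h ⟨(mul_eq_zero.mp h'.1).resolve_left hx, (mul_eq_zero.mp h'.2).resolve_left hy⟩
  by_cases hdeg : ∃ a b : ℤ, IsCoprime a b ∧ f ∣ PlaceSum.tangency f a b
  · obtain ⟨a, b, hab, hdvd⟩ := hdeg
    obtain ⟨k, hk⟩ := PlaceSum.exists_weight_of_dvd_tangency hirr.ne_zero hdvd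
    convert Set.finite_empty
    refine Set.eq_empty_iff_forall_notMem.mpr ?_
    rintro ⟨x, y⟩ ⟨hx, hy, hxy, hsm, p, q, ω, hpq, hpq0, ⟨n, hn, hω⟩, hxyω, htan⟩
    dsimp only at hx hy hxy hsm hxyω htan
    set F := x * MvPolynomial.eval ![x, y] (MvPolynomial.pderiv 0 f) with hF
    set G := y * MvPolynomial.eval ![x, y] (MvPolynomial.pderiv 1 f) with hG
    have habFG : (a : Qbar) * G = b * F := by
      have h1 : (a : Qbar) * G - b * F = k * MvPolynomial.eval ![x, y] f := by
        have hF' := hXY x y 0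
        have hG' := hXY x y 1
        simp only [Matrix.cons_val_zero, Matrix.cons_val_one] at hF' hG'
        rw [hF, hG, ← hF', ← hG', PlaceSum.eval_eq_sum_of_support_subset subset_rfl,
          Finset.mul_sum, Finset.mul_sum, Finset.mul_sum, ← Finset.sum_sub_distrib]
        refine Finset.sum_congr rfl fun m hm ↦ ?_
        rw [← hk m hm]
        push_cast
        ring
      rw [← sub_eq_zero, h1, hxy, mul_zero]
    have hpqFG : (p : Qbar) * G = q * F := by rw [hF, hG, ← mul_assoc, ← mul_assoc, htan]
    have hdet : p * b = q * a := by
      by_contra h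
      have h0 : ((p * b - q * a : ℤ) : Qbar) ≠ 0 := by exact_mod_cast sub_ne_zero.mpr h
      refine hsmooth x y hx hy hsm ⟨(mul_eq_zero.mp (?_ : _ * F = 0)).resolve_left h0,
        (mul_eq_zero.mp (?_ : _ * G = 0)).resolve_left h0⟩
      · push_cast; linear_combination (-p : Qbar) * habFG + (a : Qbar) * hpqFG
      · push_cast; linear_combination (b : Qbar) * hpqFG - (q : Qbar) * habFG
    have hab' := hab
    obtain ⟨r, t, hrt⟩ := hab'
    have hp : p = a * (r * p + t * q) := by linear_combination (-p) * hrt + t * hdet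
    have hq : q = b * (r * p + t * q) := by linear_combination (-q) * hrt - r * hdet
    have he : r * p + t * q ≠ 0 := fun h ↦ hpq0 ⟨by rw [hp, h, mul_zero], by rw [hq, h, mul_zero]⟩
    refine hnt ⟨a, b, x ^ a * y ^ b, ?_, ⟨(r * p + t * q).natAbs * n, by positivity, ?_⟩, ?_⟩
    · rintro ⟨rfl, rfl⟩
      exact not_isCoprime_zero_zero hab
    · have h1 : (x ^ a * y ^ b) ^ (r * p + t * q) = ω := by
        rw [mul_zpow, ← zpow_mul, ← zpow_mul, ← hp, ← hq, hxyω]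
      rw [pow_mul]
      rcases Int.natAbs_eq (r * p + t * q) with h | h
      · rw [h, zpow_natCast] at h1
        rw [h1, hω]
      · rw [h, zpow_neg, zpow_natCast, inv_eq_iff_eq_inv] at h1
        rw [h1, inv_pow, hω, inv_one]
    · ext ⟨z, w⟩
      refine and_congr_right fun hz ↦ and_congr_right fun hw ↦ ?_
      exact PlaceSum.eval_eq_zero_iff_of_weight hirr hab hk hx hy hxy hz hw
  · push Not at hdeg
    have halg : @Algebra.IsAlgebraic ℚ Qbar _ _ DivisionRing.toRatAlgebra := by
      rw [Subsingleton.elim (DivisionRing.toRatAlgebra : Algebra ℚ Qbar)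
        (AlgebraicClosure.instAlgebra ℚ)]
      exact AlgebraicClosure.isAlgebraic ℚ
    obtain ⟨B, hB⟩ := PlaceSum.exists_max_le f.support hsup0 (fun m ↦ m 0) (fun m ↦ m 1)
      (fun m _ m' _ h0 h1 ↦ by
        ext i
        fin_cases i
        · exact_mod_cast h0
        · exact_mod_cast h1) (fun m ↦ f.coeff m) fun m hm ↦ MvPolynomial.mem_support_iff.mp hm
    have hfin : ((Set.Icc (-⌈B⌉) ⌈B⌉ ×ˢ Set.Icc (-⌈B⌉) ⌈B⌉) ∩
        {d : ℤ × ℤ | IsCoprime d.1 d.2}).Finite :=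
      ((Set.finite_Icc _ _).prod (Set.finite_Icc _ _)).inter_of_left _
    have hvec : Function.Injective fun P : Qbar × Qbar ↦ ![P.1, P.2] := fun P Q h ↦
      Prod.ext (congrFun h 0) (congrFun h 1)
    refine (hfin.biUnion fun d hd ↦ (PlaceSum.finite_setOf_eval_eq_zero hirr
      (hdeg d.1 d.2 hd.2)).preimage hvec.injOn).subset ?_
    rintro ⟨x, y⟩ ⟨hx, hy, hxy, hsm, p, q, ω, hpq, hpq0, ⟨n, hn, hω⟩, hxyω, htan⟩
    dsimp only at hx hy hxy hsm hxyω htan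
    have hmax : max |(p : ℝ)| |(q : ℝ)| ≤ B := by
      have hF := hXY x y 0
      have hG := hXY x y 1
      simp only [Matrix.cons_val_zero, Matrix.cons_val_one] at hF hG
      refine hB x y p q n hx hy hpq hn ?_ (by rw [hxyω, hω]) ?_ ?_
      · rw [← hxy, PlaceSum.eval_eq_sum_of_support_subset subset_rfl]
      · rw [hF, hG, ← mul_assoc, ← mul_assoc, htan]
      · rw [hF, hG]
        exact hsmooth x y hx hy hsm
    have hmem : ∀ e : ℤ, |(e : ℝ)| ≤ B → e ∈ Set.Icc (-⌈B⌉) ⌈B⌉ := fun e he ↦ by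
      rw [Set.mem_Icc, ← abs_le]
      exact_mod_cast he.trans (Int.le_ceil B)
    refine Set.mem_biUnion (x := (p, q)) ⟨⟨hmem p ((le_max_left _ _).trans hmax),
      hmem q ((le_max_right _ _).trans hmax)⟩, hpq⟩ ⟨hxy, ?_⟩
    simp only [PlaceSum.tangency, map_sub, map_mul, MvPolynomial.eval_X, MvPolynomial.eval_C,
      Matrix.cons_val_zero, Matrix.cons_val_one]
    rw [← mul_assoc, ← mul_assoc, htan, sub_self]
end

section
/- Let K₀ ⊂ Q̄ be a number field and let f ∈ K₀[X,Y] be a polynomial that is irreducible over Q̄, defining the curve C = {(x,y) ∈ (Q̄^×)² : f(x,y)=0}; assume C is not a translate of a subtorus. Then for every point P = (x,y) ∈ (Q̄^×)² with f(x,y) = 0 and ((∂f/∂X)(P), (∂f/∂Y)(P)) ≠ (0,0), and every pair of coprime integers (p,q) ≠ (0,0) with p·y·(∂f/∂Y)(P) = q·x·(∂f/∂X)(P), the degree of P satisfies [ℚ(x,y) : ℚ] ≤ (deg f)² · [K₀ : ℚ]. -/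
open NumberField IsDedekindDomain MvPolynomial
open scoped Classical

lemma two_mul_sum_range_succ_add_one (m : ℕ) :
    2 * ∑ i ∈ Finset.range (m + 1), (i + 1) = (m + 1) * (m + 2) := by
  induction m with
  | zero => simp
  | succ k ih => rw [Finset.sum_range_succ, mul_add, ih]; ring

/-- The space of polynomials of degree at most `m` in two variables has dimension
`(m + 1) (m + 2) / 2`. -/
lemma two_mul_finrank_restrictTotalDegree (k : Type*) [Field k] (m : ℕ) :
    2 * Module.finrank k (restrictTotalDegree (Fin 2) k m) = (m + 1) * (m + 2) := by
  have e : {n : Fin 2 →₀ ℕ | (n.sum fun _ e => e) ≤ m} ≃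
      ((Finset.range (m + 1)).sigma fun i => Finset.HasAntidiagonal.antidiagonal i) :=
    { toFun := fun n => ⟨⟨n.1 0 + n.1 1, (n.1 0, n.1 1)⟩, by
        have := n.2
        simp [Finsupp.sum_fintype] at this
        simp; omega⟩
      invFun := fun n => ⟨Finsupp.equivFunOnFinite.symm ![n.1.2.1, n.1.2.2], by
        obtain ⟨⟨i, a, b⟩, h⟩ := n
        simp at h
        simp [Finsupp.sum_fintype]
        omega⟩
      left_inv := fun n => by
        ext i
        fin_cases i <;> simp
      right_inv := fun n => by
        obtain ⟨⟨i, a, b⟩, h⟩ := n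
        simp at h
        obtain ⟨h, rfl⟩ := h
        simp }
  have h : Module.finrank k (restrictTotalDegree (Fin 2) k m) =
      Nat.card {n : Fin 2 →₀ ℕ | (n.sum fun _ e => e) ≤ m} :=
    Module.finrank_eq_nat_card_basis (basisRestrictSupport k _)
  rw [h, Nat.card_congr e, Nat.card_eq_fintype_card, Fintype.card_coe, Finset.card_sigma]
  simp only [Finset.Nat.card_antidiagonal]
  exact two_mul_sum_range_succ_add_one m

/-- **Bézout's bound.** A linear map on `k[X,Y]` that kills the ideal `(f, g)`, where `f` is prime
and does not divide `g`, has rank at most the product of the degrees. -/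
theorem finrank_range_le_of_prime_of_not_dvd {k A : Type*} [Field k] [AddCommGroup A] [Module k A]
    (f g : MvPolynomial (Fin 2) k) (hf : Prime f) (hfg : ¬ f ∣ g) {e : ℕ} (he : g.totalDegree ≤ e)
    (φ : MvPolynomial (Fin 2) k →ₗ[k] A) [FiniteDimensional k (LinearMap.range φ)]
    (hφf : ∀ a, φ (a * f) = 0) (hφg : ∀ a, φ (a * g) = 0) :
    Module.finrank k (LinearMap.range φ) ≤ f.totalDegree * e := by
  set d := f.totalDegree with hd
  let V := restrictTotalDegree (Fin 2) k
  have memV {n : ℕ} {a : MvPolynomial (Fin 2) k} : a ∈ V n ↔ a.totalDegree ≤ n :=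
    mem_restrictTotalDegree _ _ _
  obtain ⟨m, hm⟩ : ∃ m, ∀ n ≥ m, LinearMap.range φ = (V n).map φ := by
    obtain ⟨s, hs⟩ := (Submodule.fg_iff_finiteDimensional _).2
      (inferInstance : FiniteDimensional k (LinearMap.range φ))
    have hs' : ∀ a ∈ s, ∃ b, φ b = a := fun a ha => by
      have : a ∈ LinearMap.range φ := hs ▸ Submodule.subset_span ha
      simpa using this
    choose! r hr using hs'
    refine ⟨s.sup fun a => (r a).totalDegree, fun n hn => le_antisymm ?_ LinearMap.map_le_range⟩
    rw [← hs, Submodule.span_le]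
    intro a ha
    exact ⟨r a, memV.2 (le_trans (Finset.le_sup (f := fun a => (r a).totalDegree) ha) hn), hr a ha⟩
  let n := m + d + e
  let T : (V (m + e) × V (m + d)) →ₗ[k] V n := LinearMap.codRestrict (V n)
    ((LinearMap.mulRight k f).comp ((V (m + e)).subtype.comp (LinearMap.fst _ _ _)) +
      (LinearMap.mulRight k g).comp ((V (m + d)).subtype.comp (LinearMap.snd _ _ _))) (by
    rintro ⟨⟨a, ha⟩, ⟨b, hb⟩⟩
    rw [memV] at *
    refine (totalDegree_add _ _).trans (max_le ?_ ?_)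
    · refine (totalDegree_mul _ _).trans ?_
      simp only [Submodule.subtype_apply, LinearMap.comp_apply, LinearMap.fst_apply]
      omega
    · refine (totalDegree_mul _ _).trans ?_
      simp only [Submodule.subtype_apply, LinearMap.comp_apply, LinearMap.snd_apply]
      omega)
  have hT (a b) : (T (a, b) : MvPolynomial (Fin 2) k) = a * f + b * g := rfl
  let S : V m →ₗ[k] (V (m + e) × V (m + d)) := LinearMap.prod
    (LinearMap.codRestrict _ ((LinearMap.mulRight k (-g)).comp (V m).subtype) (by
      rintro ⟨a, ha⟩
      rw [memV] at *
      refine (totalDegree_mul _ _).trans ?_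
      simp only [Submodule.subtype_apply, totalDegree_neg]
      omega))
    (LinearMap.codRestrict _ ((LinearMap.mulRight k f).comp (V m).subtype) (by
      rintro ⟨a, ha⟩
      rw [memV] at *
      refine (totalDegree_mul _ _).trans ?_
      simp only [Submodule.subtype_apply]
      omega))
  have hker : LinearMap.ker T ≤ LinearMap.range S := by
    rintro ⟨⟨a, ha⟩, ⟨b, hb⟩⟩ h
    have h0 : a * f + b * g = 0 := by
      rw [← hT ⟨a, ha⟩ ⟨b, hb⟩, LinearMap.mem_ker.1 h]; rfl
    obtain ⟨c, rfl⟩ : f ∣ b :=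
      (hf.dvd_or_dvd ⟨-a, by linear_combination h0⟩).resolve_right hfg
    have hac : a = c * -g := mul_right_cancel₀ hf.ne_zero (by linear_combination h0)
    have hc : c ∈ V m := by
      rcases eq_or_ne c 0 with rfl | hc
      · exact zero_mem _
      · rw [memV] at *
        rw [totalDegree_mul_of_isDomain hf.ne_zero hc] at hb
        omega
    refine ⟨⟨c, hc⟩, ?_⟩
    ext1
    · exact Subtype.ext hac.symm
    · exact Subtype.ext (mul_comm _ _)
  have hrange : LinearMap.range T ≤ LinearMap.ker (φ.domRestrict (V n)) := by
    rintro _ ⟨⟨a, b⟩, rfl⟩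
    rw [LinearMap.mem_ker, LinearMap.domRestrict_apply, hT, map_add, hφf, hφg, add_zero]
  have h1 := LinearMap.finrank_range_add_finrank_ker T
  have h2 := LinearMap.finrank_range_add_finrank_ker (φ.domRestrict (V n))
  have h3 := (Submodule.finrank_mono hker).trans (LinearMap.finrank_range_le S)
  have h4 := Submodule.finrank_mono hrange
  rw [Module.finrank_prod] at h1
  have h5 : Module.finrank k (LinearMap.range φ) =
      Module.finrank k (LinearMap.range (φ.domRestrict (V n))) := by
    rw [LinearMap.range_domRestrict, hm n (by omega)]
  have e1 := two_mul_finrank_restrictTotalDegree k m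
  have e2 := two_mul_finrank_restrictTotalDegree k (m + d)
  have e3 := two_mul_finrank_restrictTotalDegree k (m + e)
  have e4 := two_mul_finrank_restrictTotalDegree k n
  rw [h5]
  simp only [V, n] at *
  nlinarith

/-- If `f` is prime and vanishes together with `g` at infinitely many points with distinct `j`-th
coordinates, then `f` divides `g`. -/
theorem dvd_of_infinite_common_zeros {k : Type*} [Field k] (f g : MvPolynomial (Fin 2) k)
    (hf : Prime f) (v : ℕ → Fin 2 → k) (j : Fin 2) (hv : Function.Injective fun n => v n j)
    (hvf : ∀ n, eval (v n) f = 0) (hvg : ∀ n, eval (v n) g = 0) : f ∣ g := by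
  by_contra hfg
  let N := f.totalDegree * g.totalDegree + 1
  let φ : MvPolynomial (Fin 2) k →ₗ[k] (Fin N → k) :=
    LinearMap.pi fun i => (aeval (v i)).toLinearMap
  have hφ (a i) : φ a i = eval (v i) a := by simp [φ, aeval_eq_eval]
  have hsurj : LinearMap.range φ = ⊤ := by
    refine LinearMap.range_eq_top.2 fun w => ?_
    have hinj : Set.InjOn (fun i : Fin N => v i j) (Finset.univ : Finset (Fin N)) :=
      fun a _ b _ h => Fin.ext (hv h)
    refine ⟨Polynomial.aeval (X j) (Lagrange.interpolate Finset.univ (fun i : Fin N => v i j) w),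
      funext fun i => ?_⟩
    rw [hφ, ← aeval_eq_eval, ← Polynomial.aeval_algHom_apply, aeval_X]
    simpa only [Polynomial.coe_aeval_eq_eval] using
      Lagrange.eval_interpolate_at_node w hinj (Finset.mem_univ i)
  have := finrank_range_le_of_prime_of_not_dvd f g hf hfg le_rfl φ
    (fun a => funext fun i => by simp [hφ, hvf]) (fun a => funext fun i => by simp [hφ, hvg])
  rw [hsurj, finrank_top, Module.finrank_fin_fun] at this
  omega

lemma coeff_X_mul_pderiv {σ R : Type*} [CommSemiring R] (i : σ) (f : MvPolynomial σ R)
    (m : σ →₀ ℕ) : coeff m (X i * pderiv i f) = m i * coeff m f := by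
  induction f using MvPolynomial.induction_on' with
  | monomial u a =>
    rw [pderiv_monomial]
    rcases Nat.eq_zero_or_pos (u i) with h | h
    · by_cases hm : u = m
      · subst hm; simp [h]
      · simp [h, coeff_monomial, hm]
    · have hu : Finsupp.single i 1 + (u - Finsupp.single i 1) = u :=
        add_tsub_cancel_of_le (Finsupp.single_le_iff.2 h)
      rw [X, monomial_mul, hu, one_mul, coeff_monomial, coeff_monomial]
      split_ifs with hm
      · subst hm; ring
      · simp
  | add f g hf hg => simp only [map_add, mul_add, coeff_add, hf, hg]

/-- The derivation `p Y ∂/∂Y - q X ∂/∂X` applied to `f`. -/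
noncomputable def tangency {k : Type*} [CommRing k] (p q : ℤ) (f : MvPolynomial (Fin 2) k) :
    MvPolynomial (Fin 2) k :=
  C (p : k) * (X 1 * pderiv 1 f) - C (q : k) * (X 0 * pderiv 0 f)

lemma coeff_tangency {k : Type*} [CommRing k] (p q : ℤ) (f : MvPolynomial (Fin 2) k)
    (m : Fin 2 →₀ ℕ) : coeff m (tangency p q f) = ((p * m 1 - q * m 0 : ℤ) : k) * coeff m f := by
  simp only [tangency, coeff_sub, coeff_C_mul, coeff_X_mul_pderiv]
  push_cast
  ring

lemma totalDegree_tangency_le {k : Type*} [CommRing k] (p q : ℤ) (f : MvPolynomial (Fin 2) k) :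
    (tangency p q f).totalDegree ≤ f.totalDegree :=
  totalDegree_le_of_support_subset fun m hm => by
    rw [mem_support_iff] at *
    rw [coeff_tangency] at hm
    exact right_ne_zero_of_mul hm

lemma map_tangency {k l : Type*} [CommRing k] [CommRing l] (φ : k →+* l) (p q : ℤ)
    (f : MvPolynomial (Fin 2) k) : map φ (tangency p q f) = tangency p q (map φ f) := by
  simp [tangency, pderiv_map]

/-- A polynomial dividing its image under `p Y ∂/∂Y - q X ∂/∂X` is supported on a line. -/
lemma exists_line_of_dvd_tangency {k : Type*} [Field k] [CharZero k] {p q : ℤ}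
    {f : MvPolynomial (Fin 2) k} (hf : f ≠ 0) (h : f ∣ tangency p q f) :
    ∃ l : ℤ, ∀ m ∈ f.support, p * m 1 - q * m 0 = l := by
  obtain ⟨c, hc⟩ := h
  obtain ⟨a, rfl⟩ : ∃ a, c = C a := by
    rcases eq_or_ne c 0 with rfl | h0
    · exact ⟨0, by simp⟩
    · refine ⟨_, totalDegree_eq_zero_iff_eq_C.1 ?_⟩
      have := totalDegree_tangency_le p q f
      rw [hc, totalDegree_mul_of_isDomain hf h0] at this
      omega
  have key : ∀ m ∈ f.support, ((p * m 1 - q * m 0 : ℤ) : k) = a := fun m hm => by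
    have := congrArg (coeff m) hc
    rw [coeff_tangency, mul_comm f, coeff_C_mul] at this
    exact mul_right_cancel₀ (mem_support_iff.1 hm) this
  obtain ⟨m₀, hm₀⟩ := support_nonempty.2 hf
  exact ⟨p * m₀ 1 - q * m₀ 0, fun m hm => by
    exact_mod_cast (key m hm).trans (key m₀ hm₀).symm⟩

/-- A polynomial supported on a line is semi-invariant under the corresponding subtorus. -/
lemma eval_translate_of_line {k : Type*} [Field k] {p q l : ℤ} {f : MvPolynomial (Fin 2) k}
    (h : ∀ m ∈ f.support, p * m 1 - q * m 0 = l) (x y : k) {t : k} (ht : t ≠ 0) :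
    eval ![x * t ^ q, y * t ^ (-p)] f = t ^ (-l) * eval ![x, y] f := by
  rw [eval_eq', eval_eq', Finset.mul_sum]
  refine Finset.sum_congr rfl fun m hm => ?_
  have e : t ^ (-l) = (t ^ q) ^ m 0 * (t ^ (-p)) ^ m 1 := by
    rw [← zpow_natCast, ← zpow_natCast, ← zpow_mul, ← zpow_mul, ← zpow_add₀ ht, ← h m hm]
    congr 1
    ring
  simp only [Fin.prod_univ_two, Matrix.cons_val_zero, Matrix.cons_val_one, mul_pow, e]
  ring

lemma exists_zpow_of_zpow_mul_zpow_eq_one {k : Type*} [Field k] {p q : ℤ} (hpq : IsCoprime p q)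
    {a b : k} (ha : a ≠ 0) (hb : b ≠ 0) (h : a ^ p * b ^ q = 1) :
    ∃ t : k, t ≠ 0 ∧ a = t ^ q ∧ b = t ^ (-p) := by
  obtain ⟨u, v, huv⟩ := hpq
  refine ⟨a ^ v * b ^ (-u), mul_ne_zero (zpow_ne_zero _ ha) (zpow_ne_zero _ hb), ?_, ?_⟩
  · calc a = a ^ (v * q) * b ^ (-u * q) * (a ^ p * b ^ q) ^ u := by
          rw [mul_zpow, ← zpow_mul, ← zpow_mul]
          calc a = a ^ (v * q + p * u) * b ^ (-u * q + q * u) := by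
                rw [show v * q + p * u = 1 by linarith, show -u * q + q * u = 0 by ring]; simp
            _ = _ := by rw [zpow_add₀ ha, zpow_add₀ hb]; ring
      _ = _ := by rw [h, one_zpow, mul_one, mul_zpow, ← zpow_mul, ← zpow_mul]
  · calc b = a ^ (v * -p) * b ^ (-u * -p) * (a ^ p * b ^ q) ^ v := by
          rw [mul_zpow, ← zpow_mul, ← zpow_mul]
          calc b = a ^ (v * -p + p * v) * b ^ (-u * -p + q * v) := by
                rw [show -u * -p + q * v = 1 by linarith, show v * -p + p * v = 0 by ring]; simp
            _ = _ := by rw [zpow_add₀ ha, zpow_add₀ hb]; ring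
      _ = _ := by rw [h, one_zpow, mul_one, mul_zpow, ← zpow_mul, ← zpow_mul]

/-- The polynomial `X^p Y^q - r`, multiplied by a monomial so as to clear denominators. -/
noncomputable def clearedBinomial {k : Type*} [CommRing k] (p q : ℤ) (r : k) :
    MvPolynomial (Fin 2) k :=
  X 0 ^ p.toNat * X 1 ^ q.toNat - C r * (X 0 ^ (-p).toNat * X 1 ^ (-q).toNat)

lemma eval_clearedBinomial_eq_zero_iff {k : Type*} [Field k] {p q : ℤ} {r x y : k} (hx : x ≠ 0)
    (hy : y ≠ 0) : eval ![x, y] (clearedBinomial p q r) = 0 ↔ x ^ p * y ^ q = r := by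
  have key {z : k} (hz : z ≠ 0) (n : ℤ) : z ^ n.toNat = z ^ n * z ^ (-n).toNat := by
    rw [← zpow_natCast, ← zpow_natCast, ← zpow_add₀ hz]
    congr 1
    omega
  have hne : x ^ (-p).toNat * y ^ (-q).toNat ≠ 0 :=
    mul_ne_zero (pow_ne_zero _ hx) (pow_ne_zero _ hy)
  have : eval ![x, y] (clearedBinomial p q r) =
      (x ^ p * y ^ q - r) * (x ^ (-p).toNat * y ^ (-q).toNat) := by
    simp only [clearedBinomial, map_sub, map_mul, map_pow, eval_X, eval_C, Matrix.cons_val_zero,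
      Matrix.cons_val_one]
    rw [key hx p, key hy q]
    ring
  rw [this, mul_eq_zero, or_iff_left hne, sub_eq_zero]

lemma zpow_mul_zpow_translate {k : Type*} [Field k] (p q : ℤ) (x y : k) {t : k} (ht : t ≠ 0) :
    (x * t ^ q) ^ p * (y * t ^ (-p)) ^ q = x ^ p * y ^ q := by
  have : (t ^ q) ^ p * (t ^ (-p)) ^ q = 1 := by
    rw [← zpow_mul, ← zpow_mul, ← zpow_add₀ ht, show q * p + -p * q = 0 by ring, zpow_zero]
  rw [mul_zpow, mul_zpow]
  linear_combination x ^ p * y ^ q * this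

lemma injective_mul_two_pow_zpow {k : Type*} [Field k] [CharZero k] {x : k} (hx : x ≠ 0) {s : ℤ}
    (hs : s ≠ 0) : Function.Injective fun n : ℕ => x * ((2 : k) ^ n) ^ s := by
  intro a b h
  have h' : ((2 : k) ^ a) ^ s = (2 ^ b) ^ s := mul_left_cancel₀ hx h
  have h2 : ((2 : ℚ) ^ a) ^ s = (2 ^ b) ^ s := by
    rw [← Rat.cast_inj (α := k)]
    push_cast
    exact h'
  rw [← zpow_natCast, ← zpow_natCast, ← zpow_mul, ← zpow_mul] at h2
  have := zpow_right_injective₀ (by norm_num) (by norm_num) h2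
  exact_mod_cast mul_right_cancel₀ hs this

/-- An irreducible curve in the torus through a point of the torus whose equation is supported on a
line is a translate of a subtorus. -/
theorem isSubtorusTranslate_curve_of_line {f : MvPolynomial (Fin 2) Qbar} (hf : Prime f)
    {p q l : ℤ} (hcop : IsCoprime p q) (hpq : ¬(p = 0 ∧ q = 0))
    (h : ∀ m ∈ f.support, p * m 1 - q * m 0 = l) {x y : Qbar} (hx : x ≠ 0) (hy : y ≠ 0)
    (hP : eval ![x, y] f = 0) : IsSubtorusTranslate (curve f) := by
  have htwo (n : ℕ) : (2 : Qbar) ^ n ≠ 0 := pow_ne_zero _ two_ne_zero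
  have hdvd : f ∣ clearedBinomial p q (x ^ p * y ^ q) := by
    let v (n : ℕ) : Fin 2 → Qbar := ![x * (2 ^ n) ^ q, y * (2 ^ n) ^ (-p)]
    have hvf (n) : eval (v n) f = 0 := by
      simp only [v]
      rw [eval_translate_of_line h x y (htwo n), hP, mul_zero]
    have hvg (n) : eval (v n) (clearedBinomial p q (x ^ p * y ^ q)) = 0 :=
      (eval_clearedBinomial_eq_zero_iff (mul_ne_zero hx (zpow_ne_zero _ (htwo n)))
        (mul_ne_zero hy (zpow_ne_zero _ (htwo n)))).2 (zpow_mul_zpow_translate p q x y (htwo n))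
    by_cases hq : q = 0
    · have hp : -p ≠ 0 := neg_ne_zero.2 fun hp => hpq ⟨hp, hq⟩
      exact dvd_of_infinite_common_zeros _ _ hf v 1 (injective_mul_two_pow_zpow hy hp) hvf hvg
    · exact dvd_of_infinite_common_zeros _ _ hf v 0 (injective_mul_two_pow_zpow hx hq) hvf hvg
  refine ⟨p, q, x ^ p * y ^ q, hpq, mul_ne_zero (zpow_ne_zero _ hx) (zpow_ne_zero _ hy), ?_⟩
  ext ⟨a, b⟩
  simp only [curve, Set.mem_ofPred_eq]
  refine and_congr_right fun ha => and_congr_right fun hb => ⟨fun hab => ?_, fun hab => ?_⟩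
  · obtain ⟨c, hc⟩ := hdvd
    refine (eval_clearedBinomial_eq_zero_iff ha hb).1 ?_
    rw [hc, map_mul, hab, zero_mul]
  · obtain ⟨t, ht, h1, h2⟩ := exists_zpow_of_zpow_mul_zpow_eq_one hcop (div_ne_zero ha hx)
      (div_ne_zero hb hy) (by
        rw [div_zpow, div_zpow, div_mul_div_comm, hab]
        exact div_self (mul_ne_zero (zpow_ne_zero _ hx) (zpow_ne_zero _ hy)))
    have ha' : a = x * t ^ q := by rw [← h1]; field_simp
    have hb' : b = y * t ^ (-p) := by rw [← h2]; field_simp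
    rw [ha', hb', eval_translate_of_line h x y ht, hP, mul_zero]

lemma totalDegree_map_of_injective {σ R S : Type*} [CommSemiring R] [CommSemiring S] {φ : R →+* S}
    (hφ : Function.Injective φ) (f : MvPolynomial σ R) :
    (map φ f).totalDegree = f.totalDegree := by
  rw [totalDegree, totalDegree, support_map_of_injective f hφ]

lemma irreducible_of_irreducible_map {σ k l : Type*} [Field k] [Field l] (φ : k →+* l)
    {f : MvPolynomial σ k} (hf : Irreducible (map φ f)) : Irreducible f := by
  have : IsLocalHom (map (σ := σ) φ) := ⟨fun a ha => by
    rw [isUnit_iff_totalDegree_of_isReduced] at *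
    rw [totalDegree_map_of_injective φ.injective, coeff_map] at ha
    exact ⟨.of_map φ _ ha.1, ha.2⟩⟩
  exact hf.of_map

/-- The degree of a common zero of coprime plane curves is at most the product of their degrees. -/
theorem finrank_adjoin_common_zero_le {k L : Type*} [Field k] [Field L] [Algebra k L]
    [Algebra.IsAlgebraic k L] (f g : MvPolynomial (Fin 2) k) (hf : Prime f) (hfg : ¬ f ∣ g) {e : ℕ}
    (he : g.totalDegree ≤ e) (x y : L) (hxf : aeval ![x, y] f = 0) (hxg : aeval ![x, y] g = 0) :
    Module.finrank k (IntermediateField.adjoin k {x, y}) ≤ f.totalDegree * e := by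
  have hr : LinearMap.range (aeval (R := k) ![x, y]).toLinearMap =
      Subalgebra.toSubmodule (IntermediateField.adjoin k {x, y}).toSubalgebra := by
    rw [IntermediateField.adjoin_toSubalgebra_of_isAlgebraic
      fun z _ => Algebra.IsAlgebraic.isAlgebraic z]
    have := Algebra.adjoin_range_eq_range_aeval k ![x, y]
    rw [Matrix.range_cons_cons_empty] at this
    rw [this]
    rfl
  have hfin : FiniteDimensional k (IntermediateField.adjoin k {x, y}) :=
    IntermediateField.finiteDimensional_adjoin fun z _ =>
      (Algebra.IsAlgebraic.isAlgebraic z).isIntegral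
  have : FiniteDimensional k (LinearMap.range (aeval (R := k) ![x, y]).toLinearMap) := by
    rw [hr]; exact hfin
  have := finrank_range_le_of_prime_of_not_dvd f g hf hfg he (aeval ![x, y]).toLinearMap
    (fun a => by simp [hxf]) (fun a => by simp [hxg])
  rw [hr] at this
  exact this

/-- **Lemma (degree bound on `C^{1,A(Qbar)}`).**
Let `K₀` be a number field (a finite extension of `ℚ` inside `Qbar`) and let `f` be a
polynomial with coefficients in `K₀` that is irreducible over `Qbar`, defining a curve `C` in
`G_m²` which is not a translate of a subtorus.  Then for every smooth point `P = (x,y)` of `C`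
and every pair of coprime integers `(p,q) ≠ (0,0)` satisfying the tangency relation
`p·y·(∂f/∂Y)(P) = q·x·(∂f/∂X)(P)`, one has `[ℚ(x,y) : ℚ] ≤ (deg f)² · [K₀ : ℚ]`. -/
theorem degree_bound_on_tangency_points
    (K₀ : IntermediateField ℚ Qbar) [FiniteDimensional ℚ K₀]
    (f : MvPolynomial (Fin 2) Qbar) (hcoeff : ∀ m, f.coeff m ∈ K₀)
    (hirr : Irreducible f)
    (hnt : ¬ IsSubtorusTranslate (curve f))
    (x y : Qbar) (hx : x ≠ 0) (hy : y ≠ 0)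
    (hP : MvPolynomial.eval ![x, y] f = 0)
    (hsmooth : ¬(MvPolynomial.eval ![x, y] (MvPolynomial.pderiv 0 f) = 0 ∧
                 MvPolynomial.eval ![x, y] (MvPolynomial.pderiv 1 f) = 0))
    (p q : ℤ) (hcop : IsCoprime p q) (hpq : ¬(p = 0 ∧ q = 0))
    (htan : (p : Qbar) * y * MvPolynomial.eval ![x, y] (MvPolynomial.pderiv 1 f)
          = (q : Qbar) * x * MvPolynomial.eval ![x, y] (MvPolynomial.pderiv 0 f)) :
    Module.finrank ℚ (IntermediateField.adjoin ℚ {x, y} : IntermediateField ℚ Qbar) ≤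
      f.totalDegree ^ 2 * Module.finrank ℚ K₀ := by
  have hf : Prime f := hirr.prime
  have halg : Algebra.IsAlgebraic ℚ Qbar := by
    convert AlgebraicClosure.isAlgebraic ℚ
    · rfl
    · exact Subsingleton.elim _ _
  obtain ⟨f₀, rfl⟩ : ∃ f₀ : MvPolynomial (Fin 2) K₀, map (algebraMap K₀ Qbar) f₀ = f :=
    mem_range_map_iff_coeffs_subset.2 fun c hc => by
      obtain ⟨m, -, rfl⟩ := mem_coeffs_iff.1 hc
      exact ⟨⟨_, hcoeff m⟩, rfl⟩
  have hfg : ¬ f₀ ∣ tangency p q f₀ := fun h => by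
    have h' := map_dvd (map (algebraMap K₀ Qbar)) h
    rw [map_tangency] at h'
    obtain ⟨l, hl⟩ := exists_line_of_dvd_tangency hf.ne_zero h'
    exact hnt (isSubtorusTranslate_curve_of_line hf hcop hpq hl hx hy hP)
  have hxg : aeval ![x, y] (tangency p q f₀) = 0 := by
    rw [aeval_def, ← eval_map, map_tangency]
    simp only [tangency, map_sub, map_mul, eval_X, eval_C, Matrix.cons_val_zero,
      Matrix.cons_val_one]
    linear_combination htan
  have hbound := finrank_adjoin_common_zero_le f₀ _ (irreducible_of_irreducible_map _ hirr).prime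
    hfg (totalDegree_tangency_le p q f₀) x y (by rwa [aeval_def, ← eval_map]) hxg
  have hfin : FiniteDimensional K₀ (IntermediateField.adjoin K₀ {x, y}) :=
    IntermediateField.finiteDimensional_adjoin fun z _ =>
      (Algebra.IsAlgebraic.isAlgebraic z).isIntegral
  have hfin' : FiniteDimensional ℚ (IntermediateField.adjoin K₀ {x, y}) :=
    FiniteDimensional.trans ℚ K₀ _
  have hle : IntermediateField.adjoin ℚ {x, y} ≤
      (IntermediateField.adjoin K₀ {x, y}).restrictScalars ℚ :=
    IntermediateField.adjoin_le_iff.2 (IntermediateField.subset_adjoin K₀ _)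
  rw [totalDegree_map_of_injective (algebraMap K₀ Qbar).injective, sq]
  calc Module.finrank ℚ (IntermediateField.adjoin ℚ {x, y} : IntermediateField ℚ Qbar)
      ≤ Module.finrank ℚ (IntermediateField.adjoin K₀ {x, y}) :=
        LinearMap.finrank_le_finrank_of_injective (f := (IntermediateField.inclusion hle).toLinearMap)
          (IntermediateField.inclusion hle).injective
    _ = Module.finrank ℚ K₀ * Module.finrank K₀ (IntermediateField.adjoin K₀ {x, y}) :=
        (Module.finrank_mul_finrank _ _ _).symm
    _ ≤ _ := by rw [mul_comm]; exact Nat.mul_le_mul_right _ hbound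
end
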